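/- arXiv:0710.0152 — 3 statements merged into one kernel-verified Lean document; each statement's English description precedes it below -/
import Mathlib

section
/- Let α ≠ α' ∈ 2^ω. Then S_{β_α} and S_{β_{α'}} each satisfy condition (M), and the pair (S_{β_α}, S_{β_{α'}}) satisfies conditions (⊥) and (⊥⁻¹). In particular, A^{S_{β_α}} ⊥ʳ_c A^{S_{β_{α'}}} and A^{S_{β_α}} ⊥ʳ_c (A^{S_{β_{α'}}})⁻¹. -/
open Set Topology

abbrev Cantor : Type := ℕ → Bool

/-- `A ⊆ X × Y` is potentially closed (`pot(Π⁰₁)`): there are finer Polish topologies on `X`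
and `Y` making `A` closed in the product. -/
def PotClosed {X Y : Type} (tX : TopologicalSpace X) (tY : TopologicalSpace Y)
    (A : Set (X × Y)) : Prop :=
  ∃ (σ : TopologicalSpace X) (τ : TopologicalSpace Y),
    σ ≤ tX ∧ τ ≤ tY ∧ @PolishSpace X σ ∧ @PolishSpace Y τ ∧
    @IsClosed (X × Y) (@instTopologicalSpaceProd X Y σ τ) A

/-- Membership in the class `D₂(Σ⁰₁)`: difference of two open sets. -/
def D2Sigma01 {Z : Type} (t : TopologicalSpace Z) (A : Set Z) : Prop :=
  ∃ U V : Set Z, @IsOpen Z t U ∧ @IsOpen Z t V ∧ A = U \ V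

/-- The rectangular continuous reducibility `A ≤ʳ_c A'`. -/
def RedRC {X Y X' Y' : Type} (tX : TopologicalSpace X) (tY : TopologicalSpace Y)
    (tX' : TopologicalSpace X') (tY' : TopologicalSpace Y')
    (A : Set (X × Y)) (A' : Set (X' × Y')) : Prop :=
  ∃ (u : X → X') (v : Y → Y'),
    @Continuous X X' tX tX' u ∧ @Continuous Y Y' tY tY' v ∧
    A = (fun p => (u p.1, v p.2)) ⁻¹' A'

/-- `≤ʳ_c` on subsets of `Cantor × Cantor` with the standard topology. -/
def RedC2 (A A' : Set (Cantor × Cantor)) : Prop :=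
  RedRC inferInstance inferInstance inferInstance inferInstance A A'

/-- `A` is `≤ʳ_c`-minimal among non-potentially closed Borel sets. -/
def MinNonPotClosed {X Y : Type} (tX : TopologicalSpace X) (tY : TopologicalSpace Y)
    (A : Set (X × Y)) : Prop :=
  ¬ PotClosed tX tY A ∧
  ∀ (X' Y' : Type) (tX' : TopologicalSpace X') (tY' : TopologicalSpace Y'),
    @PolishSpace X' tX' → @PolishSpace Y' tY' →
    ∀ A' : Set (X' × Y'),
      @MeasurableSet (X' × Y') (@borel (X' × Y') (@instTopologicalSpaceProd X' Y' tX' tY')) A' →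
      ¬ PotClosed tX' tY' A' →
      RedRC tX' tY' tX tY A' A → RedRC tX tY tX' tY' A A'

/-- The Borel reducibility `A ≤_B A'` for square sets. -/
def RedB {Z Z' : Type} (tZ : TopologicalSpace Z) (tZ' : TopologicalSpace Z')
    (A : Set (Z × Z)) (A' : Set (Z' × Z'))  : Prop :=
  ∃ u : Z → Z', @Measurable Z Z' (@borel Z tZ) (@borel Z' tZ') u ∧
    A = (fun p => (u p.1, u p.2)) ⁻¹' A'

/-- `A` is `≤_B`-minimal among non-potentially closed Borel (square) sets. -/
def MinBNonPotClosed {Z : Type} (tZ : TopologicalSpace Z) (A : Set (Z × Z)) : Prop :=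
  ¬ PotClosed tZ tZ A ∧
  ∀ (Z' : Type) (tZ' : TopologicalSpace Z'), @PolishSpace Z' tZ' →
    ∀ A' : Set (Z' × Z'),
      @MeasurableSet (Z' × Z') (@borel (Z' × Z') (@instTopologicalSpaceProd Z' Z' tZ' tZ')) A' →
      ¬ PotClosed tZ' tZ' A' →
      RedB tZ' tZ A' A → RedB tZ tZ' A A'

/-- The graph of the partial function `f` with domain `D`. -/
def graphRel {X : Type} (D : Set X) (f : X → X) : Set (X × X) :=
  {p | p.1 ∈ D ∧ p.2 = f p.1}

/-- `A^f := ⋃ₙ Graph(fₙ)`. -/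
def unionGraphs {X : Type} (D : ℕ → Set X) (f : ℕ → X → X) : Set (X × X) :=
  ⋃ n, graphRel (D n) (f n)

/-- `f` restricted to `D` is a partial homeomorphism with clopen domain and clopen range. -/
def IsPartialHomeo {X : Type} (t : TopologicalSpace X) (D : Set X) (f : X → X) : Prop :=
  @IsClopen X t D ∧ @IsClopen X t (f '' D) ∧ @ContinuousOn X X t t f D ∧
    ∃ g : X → X, @ContinuousOn X X t t g (f '' D) ∧ ∀ x ∈ D, g (f x) = x

/-- A converging situation: a nonempty zero-dimensional perfect Polish space together with
partial homeomorphisms with clopen domains and ranges such that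
`Δ(X) = closure(A^f) \ A^f`. -/
def ConvSit (X : Type) (t : TopologicalSpace X) (D : ℕ → Set X) (f : ℕ → X → X) : Prop :=
  Nonempty X ∧ @PolishSpace X t ∧
  @TopologicalSpace.IsTopologicalBasis X t {s : Set X | @IsClopen X t s} ∧
  @Perfect X t Set.univ ∧
  (∀ n, IsPartialHomeo t (D n) (f n)) ∧
  Set.diagonal X =
    @closure (X × X) (@instTopologicalSpaceProd X X t t) (unionGraphs D f) \ unionGraphs D f

/-- The domain of the restriction `f^B` of the partial map `(D, f)` to a subset `B`. -/
def subD {X : Type} (B : Set X) (D : Set X) (f : X → X) : Set ↥B :=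
  {x | (x : X) ∈ D ∧ f (x : X) ∈ B}

/-- The restriction `f^B` of `f` to `B`, as a map of the subtype (junk value outside). -/
noncomputable def subF {X : Type} (B : Set X) (f : X → X) : ↥B → ↥B :=
  fun x =>
    letI := Classical.dec (f (x : X) ∈ B)
    if h : f (x : X) ∈ B then ⟨f (x : X), h⟩ else x

/-- `A^f ∩ B²`, viewed on the subtype `B`: the union of the graphs of the `f^B_n`'s. -/
def restrGraphs {X : Type} (B : Set X) (D : ℕ → Set X) (f : ℕ → X → X) : Set (↥B × ↥B) :=
  unionGraphs (fun n => subD B (D n) (f n)) (fun n => subF B (f n))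

/-- The subspace topology on `B` induced by a topology `t` on `X`. -/
def subTop {X : Type} (t : TopologicalSpace X) (B : Set X) : TopologicalSpace ↥B :=
  @TopologicalSpace.induced ↥B X Subtype.val t

/-- The natural bijection `ψ : ω → 2^{<ω}` (enumeration by length, then lexicographically):
`ψ(n)` is the binary expansion of `n+1` with its leading one removed. -/
def psiSeq (n : ℕ) : List Bool := ((n + 1).bits.dropLast).reverse

/-- `s_n := ψ(n)0^{n-|ψ(n)|}`, a dense sequence with `|s_n| = n`. -/
def sSeq (n : ℕ) : List Bool := psiSeq n ++ List.replicate (n - (psiSeq n).length) false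

/-- The concatenation `sγ` of a finite sequence `s` with `γ ∈ 2^ω`. -/
def catSeq (s : List Bool) (γ : Cantor) : Cantor :=
  fun i => if h : i < s.length then s.get ⟨i, h⟩ else γ (i - s.length)

/-- `A₁ := {(s_n0γ, s_n1γ) : n ∈ ω, γ ∈ 2^ω}`. -/
def A1 : Set (Cantor × Cantor) :=
  {p | ∃ (n : ℕ) (γ : Cantor),
    p.1 = catSeq (sSeq n ++ [false]) γ ∧ p.2 = catSeq (sSeq n ++ [true]) γ}

/-- `Card(x↾n)`: the number of ones among the first `n` coordinates of `x`. -/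
def cardOnes (x : Cantor) (n : ℕ) : ℕ := ∑ i ∈ Finset.range n, (if x i then 1 else 0)

/-- The domain of `f^S_n`: sequences vanishing at `n` whose first `n` coordinates contain a
number of ones belonging to `S`. -/
def DSdom (S : Set ℕ) (n : ℕ) : Set Cantor := {x | x n = false ∧ cardOnes x n ∈ S}

/-- `f^S_n (s0γ) := s1γ`: flip the `n`-th coordinate to one. -/
def fSfun (n : ℕ) : Cantor → Cantor := fun x => Function.update x n true

/-- `A^S := {(s0γ, s1γ) : s ∈ 2^{<ω}, Card(s) ∈ S, γ ∈ 2^ω} = ⋃ₙ Graph(f^S_n)`. -/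
def ASet (S : Set ℕ) : Set (Cantor × Cantor) := unionGraphs (DSdom S) fSfun

/-- Condition (M) on `S ⊆ ω`. -/
def CondM (S : Set ℕ) : Prop :=
  ∀ p : ℕ, ∃ k : ℕ, ∀ q : ℕ, ∃ c : ℕ, q ≤ c ∧ c ≤ q + k ∧
    (fun m => c + m) '' (S ∩ Set.Iic p) = S ∩ Set.Icc c (c + p)

/-- Condition (H) on `S ⊆ ω`. -/
def CondH (S : Set ℕ) : Prop :=
  ∀ C : Set Cantor, @MeasurableSet Cantor (borel Cantor) C →
    ∀ σ : TopologicalSpace ↥C, σ ≤ subTop inferInstance C →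
      ConvSit ↥C σ (fun n => subD C (DSdom S n) (fSfun n)) (fun n => subF C (fSfun n)) →
      ∀ l p : ℕ, ∃ n : ℕ, l ≤ n ∧ ∃ γ : ↥C, γ ∈ subD C (DSdom S n) (fSfun n) ∧
        (fun m => cardOnes (γ : Cantor) n + m) '' (S ∩ Set.Iic p) =
          S ∩ Set.Icc (cardOnes (γ : Cantor) n) (cardOnes (γ : Cantor) n + p)

/-- Condition (⊥) on a pair `(S, S')`. -/
def CondPerp (S S' : Set ℕ) : Prop :=
  ∃ p : ℕ, ∀ c : ℕ, (fun m => c + m) '' (S ∩ Set.Iic p) ≠ S' ∩ Set.Icc c (c + p)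

/-- Condition (⊥⁻¹) on a pair `(S, S')` (stated in `ℤ` to handle subtraction). -/
def CondPerpInv (S S' : Set ℕ) : Prop :=
  ∃ p : ℕ, ∀ c : ℕ,
    (fun m : ℕ => (c : ℤ) - (m : ℤ)) '' (S ∩ Set.Iic p) ≠
      ((fun n : ℕ => (n : ℤ)) '' S') ∩ Set.Icc ((c : ℤ) - (p : ℤ)) (c : ℤ)

/-- `A⁻¹ := {(y,x) : (x,y) ∈ A}`. -/
def invRel {X : Type} (A : Set (X × X)) : Set (X × X) := {p | (p.2, p.1) ∈ A}

/-- `γ_α`: `γ_α(4n+2ε) = ε` and `γ_α(2n+1) = α(n)`. -/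
def gammaSeq (α : Cantor) (k : ℕ) : Bool :=
  if k % 2 = 1 then α (k / 2) else decide (k % 4 = 2)

/-- `β_α(i) := γ_α((i)₀)` where `(i)₀ = max {m : 2^m ∣ i+1}`, with values in `{0,1} ⊆ ω`. -/
def betaSeq (α : Cantor) (i : ℕ) : ℕ :=
  if gammaSeq α ((i + 1).factorization 2) then 1 else 0

/-- `S_β := {Σ_{i<l} (1 + β(i)) : l ∈ ω}`. -/
def Sbeta (β : ℕ → ℕ) : Set ℕ :=
  {m | ∃ l : ℕ, m = ∑ i ∈ Finset.range l, (1 + β i)}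

/-- `s_n` as a function `ℕ → Bool` (with junk value `false` beyond `n`). -/
def sSeqFn (n : ℕ) (i : ℕ) : Bool := (sSeq n).getD i false

/-- The domain of `f¹_n` (direction `d = true`) or of `(f¹_n)⁻¹` (direction `d = false`):
`x` extends `s_n` and `x(n) = !d`. -/
def step1Dom (n : ℕ) (d : Bool) : Set Cantor :=
  {x | (∀ i, i < n → x i = sSeqFn n i) ∧ x n = !d}

/-- `f¹_n` (if `d = true`) or its inverse (if `d = false`): set the `n`-th coordinate to `d`. -/
def step1Fun (n : ℕ) (d : Bool) : Cantor → Cantor := fun x => Function.update x n d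

/-- Domain of `fₙ` (direction `d = true`) or of `fₙ⁻¹` (direction `d = false`). -/
def stepDom {X : Type} (D : ℕ → Set X) (f : ℕ → X → X) (n : ℕ) (d : Bool) : Set X :=
  if d then D n else f n '' D n

/-- `fₙ` (direction `d = true`) or its inverse `gₙ` (direction `d = false`). -/
def stepFun {X : Type} (f g : ℕ → X → X) (n : ℕ) (d : Bool) : X → X :=
  if d then f n else g n

/-- An acyclic situation (Definition 26), with `g n` the inverse of `f n`. -/
def AcyclicSit (X : Type) (t : TopologicalSpace X) (D : ℕ → Set X) (f g : ℕ → X → X) : Prop :=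
  Nonempty X ∧ @PolishSpace X t ∧
  @TopologicalSpace.IsTopologicalBasis X t {s : Set X | @IsClopen X t s} ∧
  @Perfect X t Set.univ ∧
  (∀ n, IsPartialHomeo t (D n) (f n)) ∧
  (∀ n, ∀ x ∈ D n, g n (f n x) = x) ∧
  Set.diagonal X ⊆
    @closure (X × X) (@instTopologicalSpaceProd X X t t) (unionGraphs D f) \ unionGraphs D f ∧
  (∀ m : ℕ, 1 ≤ m → ∀ (v : ℕ → ℕ) (ε : ℕ → Bool),
    (∀ i, i + 1 < m → v i ≠ v (i + 1) ∨ ε i = ε (i + 1)) →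
    ∀ U : Set X, @IsClopen X t U → U.Nonempty →
      ∃ V : Set X, @IsClopen X t V ∧ V.Nonempty ∧ V ⊆ U ∧
        ∀ x ∈ V, ∀ w : ℕ → X, w 0 = x →
          (∀ i, i < m → w i ∈ stepDom D f (v i) (ε i) ∧
            w (i + 1) = stepFun f g (v i) (ε i) (w i)) →
          w m ∉ V)

/-- The relation `ℜ_Θ` on `2^{<ω}`: `e ℜ_Θ e'` iff `e = e'` or
`(e, e') = (θ_n0w, θ_n1w)` for some `n` and `w`. -/
def RTheta (θ : ℕ → List Bool) (e e' : List Bool) : Prop :=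
  e = e' ∨ ∃ (n : ℕ) (w : List Bool), e = θ n ++ false :: w ∧ e' = θ n ++ true :: w

/-- The symmetrization `s(ℜ_Θ)`. -/
def sRTheta (θ : ℕ → List Bool) (e e' : List Bool) : Prop :=
  RTheta θ e e' ∨ RTheta θ e' e

/-! ### The 2-adic valuation and the Toeplitz-like sequences `betaSeq` -/

theorem factorization_two_of_eq {n k m : ℕ} (h : n = 2 ^ k * (2 * m + 1)) :
    n.factorization 2 = k := by
  subst h
  rw [Nat.factorization_mul (by positivity) (by omega), Nat.Prime.factorization_pow Nat.prime_two]
  simp [Nat.factorization_eq_zero_of_not_dvd (show ¬ 2 ∣ 2 * m + 1 by omega)]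

theorem exists_eq_two_pow_mul_succ {n : ℕ} (h : n ≠ 0) : ∃ k m, n = 2 ^ k * (2 * m + 1) := by
  obtain ⟨k, m, hm, rfl⟩ := Nat.exists_eq_two_pow_mul_odd h
  obtain ⟨q, rfl⟩ := hm
  exact ⟨k, q, rfl⟩

theorem factorization_two_pow_mul_add {N t j : ℕ} (h0 : 0 < j) (hj : j < 2 ^ N) :
    (2 ^ N * t + j).factorization 2 = j.factorization 2 := by
  obtain ⟨k, m, rfl⟩ := exists_eq_two_pow_mul_succ h0.ne'
  have hk : k < N := by
    by_contra! hle
    have := Nat.pow_le_pow_right (show 0 < 2 by norm_num) hle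
    nlinarith
  obtain ⟨e, rfl⟩ := Nat.exists_eq_add_of_lt hk
  rw [factorization_two_of_eq rfl]
  refine factorization_two_of_eq (m := 2 ^ e * t + m) ?_
  ring

theorem factorization_two_pow_sub {B x : ℕ} (h0 : 0 < x) (hx : x < 2 ^ B) :
    (2 ^ B - x).factorization 2 = x.factorization 2 := by
  obtain ⟨k, m, rfl⟩ := exists_eq_two_pow_mul_succ h0.ne'
  have hk : k < B := by
    by_contra! hle
    have := Nat.pow_le_pow_right (show 0 < 2 by norm_num) hle
    nlinarith
  obtain ⟨e, rfl⟩ := Nat.exists_eq_add_of_lt hk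
  rw [factorization_two_of_eq rfl]
  have e1 : 2 ^ (k + e + 1) = 2 ^ k * (2 * 2 ^ e) := by ring
  rw [e1] at hx ⊢
  have hlt : 2 * m + 1 < 2 * 2 ^ e := Nat.lt_of_mul_lt_mul_left hx
  refine factorization_two_of_eq (m := 2 ^ e - m - 1) ?_
  rw [← Nat.mul_sub]
  congr 1
  omega

theorem gammaSeq_of_mod_four_eq_zero (α : Cantor) {k : ℕ} (h : k % 4 = 0) :
    gammaSeq α k = false := by
  simp [gammaSeq, show ¬ k % 2 = 1 by omega, h]

theorem gammaSeq_of_mod_four_eq_two (α : Cantor) {k : ℕ} (h : k % 4 = 2) :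
    gammaSeq α k = true := by
  simp [gammaSeq, show ¬ k % 2 = 1 by omega, h]

theorem exists_gammaSeq_add_eq (α : Cantor) (k : ℕ) (b : Bool) :
    ∃ r, 1 ≤ r ∧ r ≤ 4 ∧ gammaSeq α (k + r) = b := by
  cases b
  · exact ⟨4 - k % 4, by omega, by omega, gammaSeq_of_mod_four_eq_zero α (by omega)⟩
  · obtain ⟨r, h1, h2, h3⟩ : ∃ r, 1 ≤ r ∧ r ≤ 4 ∧ (k + r) % 4 = 2 :=
      ⟨4 - (k + 2) % 4, by omega, by omega, by omega⟩
    exact ⟨r, h1, h2, gammaSeq_of_mod_four_eq_two α h3⟩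

theorem two_pow_dvd_of_gammaSeq_shift {α α' : Cantor} {N l : ℕ}
    (h : ∀ j, 1 ≤ j → j ≤ 2 ^ (N + 5) →
      gammaSeq α (j.factorization 2) = gammaSeq α' ((l + j).factorization 2)) :
    2 ^ N ∣ l := by
  rcases Nat.eq_zero_or_pos l with rfl | hl
  · simp
  obtain ⟨k, t, rfl⟩ := exists_eq_two_pow_mul_succ hl.ne'
  refine (pow_dvd_pow 2 ?_).mul_right _
  by_contra! hk
  obtain ⟨r, hr1, hr4, hr⟩ := exists_gammaSeq_add_eq α' k (!(gammaSeq α k))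
  -- an odd `i ≤ 32` with `2 t + 1 + i` of 2-adic valuation exactly `r`
  obtain ⟨i, m, hi, him⟩ : ∃ i m, 2 * i + 1 ≤ 32 ∧
      (2 * t + 1) + (2 * i + 1) = 2 ^ r * (2 * m + 1) := by
    interval_cases r
    · exact ⟨t % 2, (2 * t + 2 + 2 * (t % 2)) / 4, by omega, by omega⟩
    · exact ⟨(6 - (t + 1) % 4) % 4, (2 * t + 2 + 2 * ((6 - (t + 1) % 4) % 4)) / 8,
        by omega, by omega⟩
    · exact ⟨(12 - (t + 1) % 8) % 8, (2 * t + 2 + 2 * ((12 - (t + 1) % 8) % 8)) / 16,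
        by omega, by omega⟩
    · exact ⟨(24 - (t + 1) % 16) % 16, (2 * t + 2 + 2 * ((24 - (t + 1) % 16) % 16)) / 32,
        by omega, by omega⟩
  have hpow : 2 ^ k * (2 * i + 1) ≤ 2 ^ (N + 5) := by
    rw [pow_add]
    exact Nat.mul_le_mul (Nat.pow_le_pow_right (by norm_num) hk.le) (by simpa using hi)
  have hj := h (2 ^ k * (2 * i + 1)) (Nat.one_le_iff_ne_zero.2 (by positivity)) hpow
  rw [← Nat.mul_add, him, factorization_two_of_eq rfl,
    factorization_two_of_eq (k := k + r) (m := m) (by ring), hr] at hj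
  simp at hj

theorem gammaSeq_eq_of_shift {α α' : Cantor} {N l : ℕ}
    (h : ∀ j, 1 ≤ j → j ≤ 2 ^ (N + 5) →
      gammaSeq α (j.factorization 2) = gammaSeq α' ((l + j).factorization 2))
    {k : ℕ} (hk : k < N) : gammaSeq α k = gammaSeq α' k := by
  obtain ⟨t, rfl⟩ := two_pow_dvd_of_gammaSeq_shift h
  have := h (2 ^ k) Nat.one_le_two_pow (Nat.pow_le_pow_right (by norm_num) (by omega))
  rwa [factorization_two_pow_mul_add (by positivity) (Nat.pow_lt_pow_right (by norm_num) hk),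
    factorization_two_of_eq (n := 2 ^ k) (k := k) (m := 0) (by simp)] at this

theorem gammaSeq_eq_of_reflection {α α' : Cantor} {N l : ℕ} (hl : 2 ^ (N + 5) < l)
    (h : ∀ j, 1 ≤ j → j ≤ 2 ^ (N + 5) →
      gammaSeq α (j.factorization 2) = gammaSeq α' ((l - j).factorization 2))
    {k : ℕ} (hk : k < N) : gammaSeq α k = gammaSeq α' k := by
  have hlB : l < 2 ^ l := Nat.lt_two_pow_self
  refine gammaSeq_eq_of_shift (l := 2 ^ l - l) (fun j h1 h2 => ?_) hk
  rw [h j h1 h2, ← factorization_two_pow_sub (B := l) (x := l - j) (by omega) (by omega),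
    show 2 ^ l - l + j = 2 ^ l - (l - j) by omega]

theorem exists_gammaSeq_ne {α α' : Cantor} (hne : α ≠ α') :
    ∃ k, gammaSeq α k ≠ gammaSeq α' k := by
  obtain ⟨n, hn⟩ := Function.ne_iff.1 hne
  refine ⟨2 * n + 1, ?_⟩
  simpa [gammaSeq, show (2 * n + 1) % 2 = 1 by omega, show (2 * n + 1) / 2 = n by omega] using hn

/-! ### The sets `Sbeta (betaSeq α)` -/

/-- The increasing enumeration of `Sbeta β`. -/
def gapSum (β : ℕ → ℕ) (l : ℕ) : ℕ := ∑ i ∈ Finset.range l, (1 + β i)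

@[simp] theorem gapSum_zero (β : ℕ → ℕ) : gapSum β 0 = 0 := rfl

theorem gapSum_succ (β : ℕ → ℕ) (l : ℕ) : gapSum β (l + 1) = gapSum β l + (1 + β l) :=
  Finset.sum_range_succ _ _

theorem mem_Sbeta {β : ℕ → ℕ} {m : ℕ} : m ∈ Sbeta β ↔ ∃ l, m = gapSum β l := Iff.rfl

theorem gapSum_mem (β : ℕ → ℕ) (l : ℕ) : gapSum β l ∈ Sbeta β := ⟨l, rfl⟩

theorem zero_mem_Sbeta (β : ℕ → ℕ) : 0 ∈ Sbeta β := ⟨0, rfl⟩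

theorem gapSum_strictMono (β : ℕ → ℕ) : StrictMono (gapSum β) :=
  strictMono_nat_of_lt_succ fun l => by rw [gapSum_succ]; omega

theorem exists_ge_mem_Sbeta (β : ℕ → ℕ) (c : ℕ) : ∃ s ∈ Sbeta β, c ≤ s :=
  ⟨_, gapSum_mem β c, (gapSum_strictMono β).le_apply⟩

theorem gapSum_add_one_mem_iff {β : ℕ → ℕ} {l : ℕ} :
    gapSum β l + 1 ∈ Sbeta β ↔ β l = 0 := by
  constructor
  · rintro ⟨l', hl'⟩
    change _ = gapSum β l' at hl'
    have h1 : l < l' := (gapSum_strictMono β).lt_iff_lt.1 (by omega)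
    have h2 := (gapSum_strictMono β).monotone (show l + 1 ≤ l' from h1)
    rw [gapSum_succ] at h2
    omega
  · intro h
    exact ⟨l + 1, by change _ = gapSum β (l + 1); rw [gapSum_succ, h]⟩

theorem gapSum_add_mem_iff {β : ℕ → ℕ} {l : ℕ} :
    gapSum β l + β l ∈ Sbeta β ↔ β l = 0 := by
  constructor
  · rintro ⟨l', hl'⟩
    change _ = gapSum β l' at hl'
    have h1 : l' < l + 1 := (gapSum_strictMono β).lt_iff_lt.1 (by rw [gapSum_succ]; omega)
    have h2 := (gapSum_strictMono β).monotone (show l' ≤ l by omega)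
    omega
  · intro h
    rw [h]
    exact gapSum_mem β l

theorem betaSeq_le_one (α : Cantor) (i : ℕ) : betaSeq α i ≤ 1 := by
  unfold betaSeq; split <;> omega

theorem gammaSeq_eq_of_betaSeq_eq {α α' : Cantor} {i j : ℕ} (h : betaSeq α i = betaSeq α' j) :
    gammaSeq α ((i + 1).factorization 2) = gammaSeq α' ((j + 1).factorization 2) := by
  unfold betaSeq at h
  split at h <;> split at h <;> simp_all

theorem betaSeq_two_pow_mul_add (α : Cantor) {N t i : ℕ} (hi : i + 1 < 2 ^ N) :
    betaSeq α (2 ^ N * t + i) = betaSeq α i := by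
  unfold betaSeq
  rw [add_assoc, factorization_two_pow_mul_add (by omega) hi]

theorem gapSum_two_pow_mul_add (α : Cantor) {N t : ℕ} :
    ∀ {l : ℕ}, l < 2 ^ N → gapSum (betaSeq α) (2 ^ N * t + l) =
      gapSum (betaSeq α) (2 ^ N * t) + gapSum (betaSeq α) l
  | 0, _ => by simp
  | l + 1, h => by
    rw [← add_assoc, gapSum_succ, gapSum_succ, gapSum_two_pow_mul_add α (by omega),
      betaSeq_two_pow_mul_add α h]
    ring

theorem gapSum_add_le (α : Cantor) (l m : ℕ) :
    gapSum (betaSeq α) (l + m) ≤ gapSum (betaSeq α) l + 2 * m := by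
  induction m with
  | zero => simp
  | succ m ih =>
    rw [← add_assoc, gapSum_succ]
    have := betaSeq_le_one α (l + m)
    omega

theorem condM_Sbeta_betaSeq (α : Cantor) : CondM (Sbeta (betaSeq α)) := by
  intro p
  have hmono := gapSum_strictMono (betaSeq α)
  obtain ⟨N, hN⟩ : ∃ N, p + 1 < 2 ^ N := ⟨p + 1, Nat.lt_two_pow_self⟩
  refine ⟨2 * 2 ^ N, fun q => ?_⟩
  have hex : ∃ t, q ≤ gapSum (betaSeq α) (2 ^ N * t) :=
    ⟨q, (Nat.le_mul_of_pos_left q (by positivity)).trans hmono.le_apply⟩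
  have hbound : gapSum (betaSeq α) (2 ^ N * Nat.find hex) ≤ q + 2 * 2 ^ N := by
    rcases Nat.eq_zero_or_pos (Nat.find hex) with h0 | hpos
    · simp [h0]
    · obtain ⟨t, ht⟩ := Nat.exists_eq_succ_of_ne_zero hpos.ne'
      have h1 := Nat.find_min hex (m := t) (by omega)
      have h2 := gapSum_add_le α (2 ^ N * t) (2 ^ N)
      rw [ht, Nat.mul_succ]
      omega
  have hge := Nat.find_spec hex
  generalize Nat.find hex = t at hbound hge
  refine ⟨_, hge, hbound, Set.Subset.antisymm ?_ ?_⟩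
  · rintro _ ⟨m, ⟨⟨l, hl⟩, hmp⟩, rfl⟩
    change m = gapSum (betaSeq α) l at hl
    have hmp : m ≤ p := hmp
    have hll : l ≤ gapSum (betaSeq α) l := hmono.le_apply
    refine ⟨⟨2 ^ N * t + l, ?_⟩, by simp, by simpa using hmp⟩
    change _ = gapSum (betaSeq α) (2 ^ N * t + l)
    rw [gapSum_two_pow_mul_add α (by omega), hl]
  · rintro _ ⟨⟨l', rfl⟩, h1, h2⟩
    change gapSum (betaSeq α) _ ≤ gapSum (betaSeq α) l' at h1
    change gapSum (betaSeq α) l' ≤ _ at h2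
    obtain ⟨l, rfl⟩ := Nat.exists_eq_add_of_le (hmono.le_iff_le.1 h1)
    have hl : l < p + 1 := by
      by_contra! hle
      have h3 := hmono.monotone (Nat.add_le_add_left hle (2 ^ N * t))
      rw [gapSum_two_pow_mul_add α hN] at h3
      have h4 : p + 1 ≤ gapSum (betaSeq α) (p + 1) := hmono.le_apply
      omega
    have hadd := gapSum_two_pow_mul_add α (t := t) (show l < 2 ^ N by omega)
    refine ⟨gapSum (betaSeq α) l, ⟨gapSum_mem _ l, ?_⟩, hadd.symm⟩
    simp only [Set.mem_Iic]
    omega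

theorem exists_not_shift_mem_Sbeta {α α' : Cantor} (hne : α ≠ α') :
    ∃ p, ∀ c, ¬ ∀ m ≤ p, (m ∈ Sbeta (betaSeq α) ↔ c + m ∈ Sbeta (betaSeq α')) := by
  obtain ⟨k, hk⟩ := exists_gammaSeq_ne hne
  have hmono := gapSum_strictMono (betaSeq α)
  refine ⟨gapSum (betaSeq α) (2 ^ (k + 1 + 5)), fun c h => hk ?_⟩
  obtain ⟨l, hl⟩ := mem_Sbeta.1 ((h 0 (Nat.zero_le _)).1 (zero_mem_Sbeta _))
  have hbeta : ∀ i < 2 ^ (k + 1 + 5),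
      gapSum (betaSeq α') (l + i) = c + gapSum (betaSeq α) i →
      betaSeq α i = betaSeq α' (l + i) := by
    intro i hi hsum
    have h1 := hmono.monotone (show i + 1 ≤ _ from hi)
    rw [gapSum_succ] at h1
    have h2 := h (gapSum (betaSeq α) i + 1) (by omega)
    rw [← add_assoc, ← hsum, gapSum_add_one_mem_iff, gapSum_add_one_mem_iff] at h2
    have := betaSeq_le_one α i
    have := betaSeq_le_one α' (l + i)
    omega
  have hsum : ∀ i ≤ 2 ^ (k + 1 + 5),
      gapSum (betaSeq α') (l + i) = c + gapSum (betaSeq α) i := by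
    intro i
    induction i with
    | zero => intro _; simpa using hl.symm
    | succ i ih =>
      intro hi
      have h1 := ih (by omega)
      rw [← add_assoc, gapSum_succ, gapSum_succ, hbeta i hi h1, h1]
      ring
  refine gammaSeq_eq_of_shift (N := k + 1) (l := l) (fun j h1 h2 => ?_) (Nat.lt_succ_self k)
  obtain ⟨i, rfl⟩ := Nat.exists_eq_add_of_le' h1
  exact gammaSeq_eq_of_betaSeq_eq (hbeta i h2 (hsum i (by omega)))

theorem exists_not_reflection_mem_Sbeta {α α' : Cantor} (hne : α ≠ α') :
    ∃ p ∈ Sbeta (betaSeq α), ∀ c, p ≤ c →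
      ¬ ∀ m ≤ p, (m ∈ Sbeta (betaSeq α) ↔ c - m ∈ Sbeta (betaSeq α')) := by
  obtain ⟨k, hk⟩ := exists_gammaSeq_ne hne
  have hmono := gapSum_strictMono (betaSeq α)
  refine ⟨gapSum (betaSeq α) (2 ^ (k + 1 + 5)), gapSum_mem _ _, fun c hc h => hk ?_⟩
  obtain ⟨l, hl⟩ := mem_Sbeta.1 ((h 0 (Nat.zero_le _)).1 (zero_mem_Sbeta _))
  have hbeta : ∀ i < 2 ^ (k + 1 + 5), ∀ r,
      gapSum (betaSeq α') (r + 1) + gapSum (betaSeq α) i = c →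
      betaSeq α i = betaSeq α' r := by
    intro i hi r hsum
    have h1 := hmono.monotone (show i + 1 ≤ _ from hi)
    rw [gapSum_succ] at h1
    have h2 := h (gapSum (betaSeq α) i + 1) (by omega)
    rw [gapSum_succ] at hsum
    rw [show c - (gapSum (betaSeq α) i + 1) = gapSum (betaSeq α') r + betaSeq α' r by omega,
      gapSum_add_one_mem_iff, gapSum_add_mem_iff] at h2
    have := betaSeq_le_one α i
    have := betaSeq_le_one α' r
    omega
  have hsum : ∀ i ≤ 2 ^ (k + 1 + 5), ∃ r, r + i = l ∧
      gapSum (betaSeq α') r + gapSum (betaSeq α) i = c := by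
    intro i
    induction i with
    | zero => intro _; exact ⟨l, rfl, by simpa using hl.symm⟩
    | succ i ih =>
      intro hi
      obtain ⟨r, hr, h1⟩ := ih (by omega)
      rcases r with _ | r
      · have := hmono hi
        simp only [gapSum_zero] at h1
        omega
      · have h2 := hbeta i hi r h1
        refine ⟨r, by omega, ?_⟩
        rw [gapSum_succ] at h1 ⊢
        omega
  obtain ⟨r, hr, -⟩ := hsum _ le_rfl
  refine gammaSeq_eq_of_reflection (N := k + 1) (l := l + 1) (by omega)
    (fun j h1 h2 => ?_) (Nat.lt_succ_self k)
  obtain ⟨i, rfl⟩ := Nat.exists_eq_add_of_le' h1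
  obtain ⟨r, hr, h3⟩ := hsum i (by omega)
  obtain ⟨r, rfl⟩ := Nat.exists_eq_succ_of_ne_zero (show r ≠ 0 by omega)
  rw [gammaSeq_eq_of_betaSeq_eq (hbeta i h2 r h3), show l + 1 - (i + 1) = r + 1 by omega]

theorem condPerp_Sbeta_betaSeq {α α' : Cantor} (hne : α ≠ α') :
    CondPerp (Sbeta (betaSeq α)) (Sbeta (betaSeq α')) := by
  obtain ⟨p, hp⟩ := exists_not_shift_mem_Sbeta hne
  refine ⟨p, fun c h => hp c fun m hm => ?_⟩
  have := Set.ext_iff.1 h (c + m)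
  simpa [hm] using this

theorem condPerpInv_Sbeta_betaSeq {α α' : Cantor} (hne : α ≠ α') :
    CondPerpInv (Sbeta (betaSeq α)) (Sbeta (betaSeq α')) := by
  obtain ⟨p, hpS, hp⟩ := exists_not_reflection_mem_Sbeta hne
  refine ⟨p, fun c h => ?_⟩
  have hpc : p ≤ c := by
    obtain ⟨⟨n, -, hn⟩, -⟩ := h.subset ⟨p, ⟨hpS, Set.self_mem_Iic⟩, rfl⟩
    simp only at hn
    omega
  refine hp c hpc fun m hm => ?_
  have := Set.ext_iff.1 h ((c : ℤ) - m)
  have hcm : (c : ℤ) - m = ((c - m : ℕ) : ℤ) := by omega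
  constructor
  · intro hmS
    obtain ⟨⟨n, hn, hn'⟩, -⟩ := this.1 ⟨m, ⟨hmS, hm⟩, rfl⟩
    simp only at hn'
    rwa [show c - m = n by omega]
  · intro hmS
    obtain ⟨n, ⟨hn, -⟩, hn'⟩ := this.2 ⟨⟨c - m, hmS, hcm.symm⟩, by simp; omega, by simp⟩
    simp only at hn'
    rwa [show m = n by omega]

/-! ### The relations `ASet S` -/

theorem mem_ASet {S : Set ℕ} {x y : Cantor} :
    (x, y) ∈ ASet S ↔
      ∃ n, x n = false ∧ cardOnes x n ∈ S ∧ y = Function.update x n true := by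
  simp [ASet, unionGraphs, graphRel, DSdom, fSfun, and_assoc]

theorem not_mem_ASet_self {S : Set ℕ} {x : Cantor} : (x, x) ∉ ASet S := by
  rw [mem_ASet]
  rintro ⟨n, h1, -, h2⟩
  have := congrFun h2 n
  rw [h1, Function.update_self] at this
  simp at this

theorem cardOnes_congr {x y : Cantor} {n : ℕ} (h : ∀ i < n, x i = y i) :
    cardOnes x n = cardOnes y n :=
  Finset.sum_congr rfl fun i hi => by rw [h i (Finset.mem_range.1 hi)]

theorem cardOnes_update_true {x : Cantor} {i n : ℕ} (hi : i < n) (hx : x i = false) :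
    cardOnes (Function.update x i true) n = cardOnes x n + 1 := by
  unfold cardOnes
  rw [← Finset.add_sum_erase _ _ (Finset.mem_range.2 hi),
    ← Finset.add_sum_erase _ (fun j => if x j then 1 else 0) (Finset.mem_range.2 hi), hx]
  simp only [Function.update_self, if_true]
  rw [Finset.sum_congr rfl fun j hj => by
    rw [Function.update_of_ne (Finset.ne_of_mem_erase hj)]]
  simp [add_comm]

theorem cardOnes_update_false {x : Cantor} {i n : ℕ} (hi : i < n) (hx : x i = true) :
    cardOnes (Function.update x i false) n + 1 = cardOnes x n := by
  have h := cardOnes_update_true (x := Function.update x i false) hi (by simp)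
  rw [← h, Function.update_idem, ← hx, Function.update_eq_self]

theorem eventually_eq_of_continuous {Z : Type*} [TopologicalSpace Z] {f : Z → Bool}
    (hf : Continuous f) (z : Z) : ∀ᶠ w in 𝓝 z, f w = f z := by
  have := hf.tendsto z
  rwa [nhds_discrete Bool, Filter.tendsto_pure] at this

theorem tendsto_of_agree {y : ℕ → Cantor} {x : Cantor} (h : ∀ M, ∀ i < M, y M i = x i) :
    Filter.Tendsto y Filter.atTop (𝓝 x) := by
  rw [tendsto_pi_nhds]
  intro i
  refine tendsto_const_nhds.congr' ?_
  filter_upwards [Filter.eventually_gt_atTop i] with M hM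
  exact (h M i hM).symm

theorem exists_forall_agree {u : Cantor → Cantor} (hu : Continuous u) (x : Cantor) (K : ℕ) :
    ∃ M, ∀ y : Cantor, (∀ i < M, y i = x i) → ∀ i < K, u y i = u x i := by
  by_contra! hcon
  choose y hy hne using hcon
  have hev : ∀ᶠ z in 𝓝 x, ∀ i ∈ Finset.range K, u z i = u x i := by
    rw [Finset.eventually_all]
    exact fun i _ => eventually_eq_of_continuous (f := fun z => u z i) (by fun_prop) x
  obtain ⟨M, hM⟩ := ((tendsto_of_agree hy).eventually hev).exists
  obtain ⟨i, hi, h⟩ := hne M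
  exact h (hM i (Finset.mem_range.2 hi))

theorem diag_mem_closure_ASet {S : Set ℕ} (hS : ∀ c, ∃ s ∈ S, c ≤ s) (x : Cantor) :
    (x, x) ∈ closure (ASet S) := by
  have key : ∀ M, ∃ y z : Cantor, (∀ i < M, y i = x i) ∧ (∀ i < M, z i = x i) ∧
      (y, z) ∈ ASet S := by
    intro M
    obtain ⟨s, hs, hle⟩ := hS (cardOnes x M)
    obtain ⟨e, rfl⟩ := Nat.exists_eq_add_of_le hle
    let y : Cantor := fun i => if i < M then x i else decide (i < M + e)
    have hy : ∀ i < M, y i = x i := fun i hi => if_pos hi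
    refine ⟨y, Function.update y (M + e) true, hy, fun i hi => ?_,
      mem_ASet.2 ⟨M + e, by simp [y], ?_, rfl⟩⟩
    · rw [Function.update_of_ne (by omega), hy i hi]
    · have hcard : cardOnes y (M + e) = cardOnes x M + e := by
        rw [← cardOnes_congr hy]
        unfold cardOnes
        rw [Finset.sum_range_add]
        congr 1
        rw [Finset.sum_congr rfl fun i hi => show _ = 1 by
          simp [y, Finset.mem_range.1 hi]]
        simp
      rwa [hcard]
  choose y z hy hz hmem using key
  exact mem_closure_of_tendsto ((tendsto_of_agree hy).prodMk_nhds (tendsto_of_agree hz))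
    (Filter.Eventually.of_forall hmem)

theorem eq_or_mem_of_mem_closure_ASet {S : Set ℕ} {x y : Cantor}
    (h : (x, y) ∈ closure (ASet S)) : x = y ∨ (x, y) ∈ ASet S := by
  by_contra! hcon
  obtain ⟨hne, hnot⟩ := hcon
  have key : ∀ K, ∃ z w : Cantor, (∀ i < K, z i = x i) ∧ (∀ i < K, w i = y i) ∧
      (z, w) ∈ ASet S := by
    intro K
    have hev : ∀ᶠ p : Cantor × Cantor in 𝓝 (x, y),
        ∀ i ∈ Finset.range K, p.1 i = x i ∧ p.2 i = y i := by
      rw [Finset.eventually_all]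
      intro i _
      exact (eventually_eq_of_continuous (f := fun p : Cantor × Cantor => p.1 i)
        (by fun_prop) (x, y)).and (eventually_eq_of_continuous
          (f := fun p : Cantor × Cantor => p.2 i) (by fun_prop) (x, y))
    obtain ⟨⟨z, w⟩, hzw, hmem⟩ := ((mem_closure_iff_frequently.1 h).and_eventually hev).exists
    exact ⟨z, w, fun i hi => (hmem i (Finset.mem_range.2 hi)).1,
      fun i hi => (hmem i (Finset.mem_range.2 hi)).2, hzw⟩
  obtain ⟨n, hn⟩ := Function.ne_iff.1 hne
  have main : ∀ K, n < K → x n = false ∧ cardOnes x n ∈ S ∧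
      ∀ i < K, y i = Function.update x n true i := by
    intro K hK
    obtain ⟨z, w, hz, hw, hzw⟩ := key K
    obtain ⟨m, h1, h2, rfl⟩ := mem_ASet.1 hzw
    have hmn : m = n := by
      by_contra hmn
      refine hn ?_
      rw [← hz n hK, ← hw n hK, Function.update_of_ne (Ne.symm hmn)]
    subst hmn
    refine ⟨by rw [← hz m hK, h1], ?_, fun i hi => ?_⟩
    · rwa [← cardOnes_congr fun i hi => hz i (hi.trans hK)]
    · rw [← hw i hi]
      by_cases him : i = m
      · simp [him]
      · simp [Function.update_of_ne him, hz i hi]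
  obtain ⟨h1, h2, -⟩ := main (n + 1) (Nat.lt_succ_self n)
  refine hnot (mem_ASet.2 ⟨n, h1, h2, funext fun i => ?_⟩)
  exact (main (n + i + 1) (by omega)).2.2 i (by omega)

/-! ### Continuous maps that send the edges of `ASet S` to edges of `ASet S'` or its inverse -/

/-- `x` and `y` differ exactly at one coordinate, where `y` takes the value `d`, and the number
of ones before it belongs to `S`: this is the relation `ASet S` if `d = true`, and its inverse
if `d = false`. -/
def FlipTo (d : Bool) (S : Set ℕ) (x y : Cantor) : Prop :=
  ∃ n, x n = !d ∧ cardOnes x n ∈ S ∧ y = Function.update x n d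

theorem flipTo_true {S : Set ℕ} {x y : Cantor} : FlipTo true S x y ↔ (x, y) ∈ ASet S :=
  mem_ASet.symm

theorem flipTo_false {S : Set ℕ} {x y : Cantor} : FlipTo false S x y ↔ (y, x) ∈ ASet S := by
  rw [mem_ASet]
  constructor
  · rintro ⟨n, h1, h2, rfl⟩
    refine ⟨n, by simp, ?_, ?_⟩
    · rwa [cardOnes_congr fun i hi => Function.update_of_ne hi.ne _ _]
    · rw [Function.update_idem, ← show x n = true from h1, Function.update_eq_self]
  · rintro ⟨n, h1, h2, rfl⟩
    refine ⟨n, by simp, ?_, ?_⟩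
    · rwa [cardOnes_congr fun i hi => Function.update_of_ne hi.ne _ _]
    · rw [Function.update_idem, ← h1, Function.update_eq_self]

theorem cardOnes_eq_zero {x : Cantor} {n : ℕ} (h : ∀ i < n, x i = false) : cardOnes x n = 0 :=
  Finset.sum_eq_zero fun i hi => by simp [h i (Finset.mem_range.1 hi)]

theorem exists_flip_position {S S' : Set ℕ} (h0 : 0 ∈ S) {u : Cantor → Cantor}
    (hu : Continuous u) {d : Bool}
    (H : ∀ x y, (x, y) ∈ ASet S ↔ FlipTo d S' (u x) (u y)) (B : ℕ) :
    ∃ n a N, B ≤ n ∧ n < N ∧ B ≤ a ∧ ∀ x : Cantor, (∀ i < N, x i = false) →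
      u x a = !d ∧ u (Function.update x n true) = Function.update (u x) a d := by
  let z : Cantor := fun _ => false
  have hedge : ∀ n (x : Cantor), (∀ i < n + 1, x i = false) →
      FlipTo d S' (u x) (u (Function.update x n true)) := by
    intro n x hx
    refine (H _ _).1 (mem_ASet.2 ⟨n, hx n (by omega), ?_, rfl⟩)
    rwa [cardOnes_eq_zero fun i hi => hx i (by omega)]
  obtain ⟨M, hM⟩ := exists_forall_agree hu z B
  obtain ⟨n, hBn, hMn⟩ : ∃ n, B ≤ n ∧ M ≤ n := ⟨max B M, le_max_left _ _, le_max_right _ _⟩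
  obtain ⟨a, ha, -, hua⟩ := hedge n z fun _ _ => rfl
  have hBa : B ≤ a := by
    by_contra! hlt
    have := hM (Function.update z n true)
      (fun i hi => Function.update_of_ne (by omega) _ _) a hlt
    rw [hua, ha] at this
    simp at this
  obtain ⟨N₁, hN₁⟩ := exists_forall_agree hu z (a + 1)
  obtain ⟨N₂, hN₂⟩ := exists_forall_agree hu (Function.update z n true) (a + 1)
  refine ⟨n, a, N₁ + N₂ + n + 1, hBn, by omega, hBa, fun x hx => ?_⟩
  have hxa : u x a = !d := by
    rw [← ha]
    exact hN₁ x (fun i hi => hx i (by omega)) a (by omega)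
  have hya : u (Function.update x n true) a = d := by
    rw [hN₂ (Function.update x n true) (fun i hi => ?_) a (by omega), hua,
      Function.update_self]
    by_cases hin : i = n
    · simp [hin]
    · simp only [Function.update_of_ne hin]
      exact hx i (by omega)
  obtain ⟨b, -, -, hub⟩ := hedge n x fun i hi => hx i (by omega)
  have hab : a = b := by
    by_contra hab
    rw [hub, Function.update_of_ne hab, hxa] at hya
    simp at hya
  subst hab
  exact ⟨hxa, hub⟩

theorem exists_flip_family {S S' : Set ℕ} (h0 : 0 ∈ S) {u : Cantor → Cantor}
    (hu : Continuous u) {d : Bool}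
    (H : ∀ x y, (x, y) ∈ ASet S ↔ FlipTo d S' (u x) (u y)) (p : ℕ) :
    ∀ B, ∃ n a c, B ≤ n ∧ B ≤ a ∧ ∀ m ≤ p, ∃ x : Cantor, (∀ i < B, x i = false) ∧
      x n = false ∧ cardOnes x n = m ∧ u x a = !d ∧
      u (Function.update x n true) = Function.update (u x) a d ∧
      cardOnes (u x) a + (if d then 0 else m) = c + (if d then m else 0) := by
  induction p with
  | zero =>
    intro B
    obtain ⟨n, a, N, hn, -, ha, h⟩ := exists_flip_position h0 hu H B
    refine ⟨n, a, cardOnes (u fun _ => false) a, hn, ha, fun m hm => ?_⟩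
    obtain rfl : m = 0 := by omega
    have := h (fun _ => false) fun _ _ => rfl
    exact ⟨fun _ => false, fun _ _ => rfl, rfl, cardOnes_eq_zero fun _ _ => rfl, this.1, this.2,
      by simp⟩
  | succ p ih =>
    intro B
    obtain ⟨n₀, a₀, N, hn₀, hN, ha₀, h⟩ := exists_flip_position h0 hu H B
    obtain ⟨n, a, c, hn, ha, hfam⟩ := ih (N + a₀ + 1)
    refine ⟨n, a, c, by omega, by omega, fun m hm => ?_⟩
    rcases Nat.lt_or_ge p m with hpm | hmp
    · obtain rfl : m = p + 1 := by omega
      obtain ⟨x, hx, hxn, hcard, hxa, hflip, hc⟩ := hfam p le_rfl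
      obtain ⟨hxa₀, hflip₀⟩ := h x fun i hi => hx i (by omega)
      refine ⟨Function.update x n₀ true, fun i hi => ?_, ?_, ?_, ?_, ?_, ?_⟩
      · rw [Function.update_of_ne (by omega)]
        exact hx i (by omega)
      · rwa [Function.update_of_ne (by omega)]
      · rw [cardOnes_update_true (by omega) (hx _ (by omega)), hcard]
      · rwa [hflip₀, Function.update_of_ne (by omega)]
      · rw [Function.update_comm (by omega), (h (Function.update x n true) fun i hi => ?_).2,
          hflip, hflip₀, Function.update_comm (by omega)]
        rw [Function.update_of_ne (by omega)]
        exact hx i (by omega)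
      · rw [hflip₀]
        cases d
        · have := cardOnes_update_false (n := a) (by omega) hxa₀
          simp only [Bool.false_eq_true, if_false] at hc ⊢
          omega
        · have := cardOnes_update_true (n := a) (by omega) hxa₀
          simp only [if_true] at hc ⊢
          omega
    · obtain ⟨x, hx, hrest⟩ := hfam m hmp
      exact ⟨x, fun i hi => hx i (by omega), hrest⟩

theorem exists_mem_iff_mem_of_flipTo {S S' : Set ℕ} (h0 : 0 ∈ S) {u : Cantor → Cantor}
    (hu : Continuous u) {d : Bool}
    (H : ∀ x y, (x, y) ∈ ASet S ↔ FlipTo d S' (u x) (u y)) (p : ℕ) :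
    ∃ c, ∀ m ≤ p, ∃ e, e + (if d then 0 else m) = c + (if d then m else 0) ∧
      (m ∈ S ↔ e ∈ S') := by
  obtain ⟨n, a, c, -, -, hfam⟩ := exists_flip_family h0 hu H p 0
  refine ⟨c, fun m hm => ?_⟩
  obtain ⟨x, -, hxn, hcard, hxa, hflip, hc⟩ := hfam m hm
  refine ⟨_, hc, ?_⟩
  have hiff := H x (Function.update x n true)
  rw [hflip, mem_ASet] at hiff
  constructor
  · intro hmS
    obtain ⟨b, hb, hbS, hub⟩ := hiff.1 ⟨n, hxn, by rwa [hcard], rfl⟩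
    have hab : a = b := by
      by_contra hab
      have := congrFun hub a
      rw [Function.update_self, Function.update_of_ne hab, hxa] at this
      simp at this
    rwa [hab]
  · intro haS
    obtain ⟨b, hb, hbS, hub⟩ := hiff.2 ⟨a, hxa, haS, rfl⟩
    have hnb : n = b := by
      by_contra hnb
      have := congrFun hub n
      rw [Function.update_self, Function.update_of_ne hnb, hxn] at this
      simp at this
    rwa [← hcard, hnb]

theorem not_forall_mem_ASet_iff_flipTo_true {α α' : Cantor} (hne : α ≠ α') {u : Cantor → Cantor}
    (hu : Continuous u) :
    ¬ ∀ x y, (x, y) ∈ ASet (Sbeta (betaSeq α)) ↔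
      FlipTo true (Sbeta (betaSeq α')) (u x) (u y) := by
  intro H
  obtain ⟨p, hp⟩ := exists_not_shift_mem_Sbeta hne
  obtain ⟨c, hc⟩ := exists_mem_iff_mem_of_flipTo (zero_mem_Sbeta _) hu H p
  refine hp c fun m hm => ?_
  obtain ⟨e, he, hiff⟩ := hc m hm
  simp only [if_true, add_zero] at he
  rwa [← he]

theorem not_forall_mem_ASet_iff_flipTo_false {α α' : Cantor} (hne : α ≠ α') {u : Cantor → Cantor}
    (hu : Continuous u) :
    ¬ ∀ x y, (x, y) ∈ ASet (Sbeta (betaSeq α)) ↔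
      FlipTo false (Sbeta (betaSeq α')) (u x) (u y) := by
  intro H
  obtain ⟨p, -, hp⟩ := exists_not_reflection_mem_Sbeta hne
  obtain ⟨c, hc⟩ := exists_mem_iff_mem_of_flipTo (zero_mem_Sbeta _) hu H p
  have key : ∀ m ≤ p, ∃ e, e + m = c ∧
      (m ∈ Sbeta (betaSeq α) ↔ e ∈ Sbeta (betaSeq α')) := by
    simpa using hc
  obtain ⟨e, he, -⟩ := key p le_rfl
  refine hp c (by omega) fun m hm => ?_
  obtain ⟨e, he, hiff⟩ := key m hm
  rwa [show c - m = e by omega]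

theorem eq_of_map_ASet {S S' : Set ℕ} (hS : ∀ c, ∃ s ∈ S, c ≤ s) {u v : Cantor → Cantor}
    (hu : Continuous u) (hv : Continuous v)
    (H : ∀ x y, (x, y) ∈ ASet S ↔ (u x, v y) ∈ ASet S') : u = v := by
  funext x
  have hmem : (u x, v x) ∈ closure (ASet S') :=
    map_mem_closure (f := fun p : Cantor × Cantor => (u p.1, v p.2)) (by fun_prop)
      (diag_mem_closure_ASet hS x) fun p hp => (H p.1 p.2).1 hp
  exact (eq_or_mem_of_mem_closure_ASet hmem).resolve_right fun h =>
    not_mem_ASet_self ((H x x).2 h)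

theorem eq_of_map_ASet_inv {S S' : Set ℕ} (hS : ∀ c, ∃ s ∈ S, c ≤ s) {u v : Cantor → Cantor}
    (hu : Continuous u) (hv : Continuous v)
    (H : ∀ x y, (x, y) ∈ ASet S ↔ (v y, u x) ∈ ASet S') : u = v := by
  funext x
  have hmem : (v x, u x) ∈ closure (ASet S') :=
    map_mem_closure (f := fun p : Cantor × Cantor => (v p.2, u p.1)) (by fun_prop)
      (diag_mem_closure_ASet hS x) fun p hp => (H p.1 p.2).1 hp
  exact ((eq_or_mem_of_mem_closure_ASet hmem).resolve_right fun h =>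
    not_mem_ASet_self ((H x x).2 h)).symm

theorem not_redC2_ASet {α α' : Cantor} (hne : α ≠ α') :
    ¬ RedC2 (ASet (Sbeta (betaSeq α))) (ASet (Sbeta (betaSeq α'))) := by
  rintro ⟨u, v, hu, hv, huv⟩
  have H : ∀ x y, (x, y) ∈ ASet (Sbeta (betaSeq α)) ↔
      (u x, v y) ∈ ASet (Sbeta (betaSeq α')) := fun x y => Set.ext_iff.1 huv (x, y)
  obtain rfl := eq_of_map_ASet (exists_ge_mem_Sbeta _) hu hv H
  exact not_forall_mem_ASet_iff_flipTo_true hne hu fun x y => (H x y).trans flipTo_true.symm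

theorem not_map_ASet_inv {α α' : Cantor} (hne : α ≠ α') {u v : Cantor → Cantor}
    (hu : Continuous u) (hv : Continuous v) :
    ¬ ∀ x y, (x, y) ∈ ASet (Sbeta (betaSeq α)) ↔ (v y, u x) ∈ ASet (Sbeta (betaSeq α')) := by
  intro H
  obtain rfl := eq_of_map_ASet_inv (exists_ge_mem_Sbeta _) hu hv H
  exact not_forall_mem_ASet_iff_flipTo_false hne hu fun x y => (H x y).trans flipTo_false.symm

theorem stmt15 (α α' : Cantor) (hne : α ≠ α') :
    CondM (Sbeta (betaSeq α)) ∧ CondM (Sbeta (betaSeq α')) ∧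
    CondPerp (Sbeta (betaSeq α)) (Sbeta (betaSeq α')) ∧
    CondPerpInv (Sbeta (betaSeq α)) (Sbeta (betaSeq α')) ∧
    (¬ RedC2 (ASet (Sbeta (betaSeq α))) (ASet (Sbeta (betaSeq α'))) ∧
      ¬ RedC2 (ASet (Sbeta (betaSeq α'))) (ASet (Sbeta (betaSeq α)))) ∧
    (¬ RedC2 (ASet (Sbeta (betaSeq α))) (invRel (ASet (Sbeta (betaSeq α')))) ∧
      ¬ RedC2 (invRel (ASet (Sbeta (betaSeq α')))) (ASet (Sbeta (betaSeq α)))) := by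
  refine ⟨condM_Sbeta_betaSeq α, condM_Sbeta_betaSeq α', condPerp_Sbeta_betaSeq hne,
    condPerpInv_Sbeta_betaSeq hne, ⟨not_redC2_ASet hne, not_redC2_ASet hne.symm⟩, ?_, ?_⟩
  · rintro ⟨u, v, hu, hv, huv⟩
    exact not_map_ASet_inv hne hu hv fun x y => Set.ext_iff.1 huv (x, y)
  · rintro ⟨u, v, hu, hv, huv⟩
    exact not_map_ASet_inv hne.symm hv hu fun x y => Set.ext_iff.1 huv (y, x)
end

section
/- Let α ∈ 2^ω, let v ∈ ω^{<ω} be nonempty, and let ε ∈ {−1,1}^{|v|}. Assume that for every i < |v|−1, v(i) ≠ v(i+1) or ε(i) ≠ −ε(i+1). Then (f¹_{v(|v|−1)})^{ε(|v|−1)} ∘ … ∘ (f¹_{v(0)})^{ε(0)}(α) is either undefined or different from α. -/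
open Set Topology

/-- A walk of partial flips keeps its `N`-th coordinate as long as no step flips `N`. -/
lemma walk_apply_eq {m : ℕ} {v : ℕ → ℕ} {ε : ℕ → Bool} {w : ℕ → Cantor}
    (hstep : ∀ i, i < m → w (i + 1) = step1Fun (v i) (ε i) (w i))
    {N p q : ℕ} (hpq : p ≤ q) (hq : q ≤ m) (hv : ∀ k, p ≤ k → k < q → v k ≠ N) :
    w q N = w p N := by
  induction q, hpq using Nat.le_induction with
  | base => rfl
  | succ q hpq ih =>
    rw [hstep q (by omega), step1Fun, Function.update_of_ne (hv q hpq q.lt_succ_self).symm]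
    exact ih (by omega) fun k hk hkq => hv k hk (by omega)

/-- A reduced walk of partial flips never returns to a point already visited. -/
lemma walk_add_ne {m : ℕ} {v : ℕ → ℕ} {ε : ℕ → Bool} {w : ℕ → Cantor}
    (hnc : ∀ i, i + 1 < m → v i ≠ v (i + 1) ∨ ε i = ε (i + 1))
    (hstep : ∀ i, i < m →
      w i ∈ step1Dom (v i) (ε i) ∧ w (i + 1) = step1Fun (v i) (ε i) (w i))
    (l : ℕ) (hl : 1 ≤ l) (i : ℕ) (him : i + l ≤ m) : w (i + l) ≠ w i := by
  induction l using Nat.strong_induction_on generalizing i with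
  | _ l ih =>
    intro hret
    have hfun := fun k hk => (hstep k hk).2
    obtain ⟨c, hc, hmax⟩ := Finset.exists_max_image (Finset.Ico i (i + l)) v
      ⟨i, Finset.mem_Ico.2 ⟨le_rfl, by omega⟩⟩
    simp only [Finset.mem_Ico] at hc hmax
    -- `a` is the first time the largest coordinate is flipped, `b` the second
    have hexa : ∃ a, i ≤ a ∧ v a = v c := ⟨c, hc.1, rfl⟩
    obtain ⟨a, ⟨hia, hva⟩, hamin⟩ :
        ∃ a, (i ≤ a ∧ v a = v c) ∧ ∀ k, k < a → ¬ (i ≤ k ∧ v k = v c) :=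
      ⟨Nat.find hexa, Nat.find_spec hexa, fun k hk => Nat.find_min hexa hk⟩
    have hac : a ≤ c := not_lt.1 fun h => hamin c h ⟨hc.1, rfl⟩
    have hwa : w a (v c) = w i (v c) :=
      walk_apply_eq hfun hia (by omega) fun k hk hka h => hamin k hka ⟨hk, h⟩
    have hda : w a (v c) = !ε a := hva ▸ (hstep a (by omega)).1.2
    have hsa : w (a + 1) (v c) = ε a := by
      rw [hfun a (by omega), step1Fun, hva, Function.update_self]
    have hexb : ∃ b, a + 1 ≤ b ∧ b < i + l ∧ v b = v c := by
      by_contra! hno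
      have hend : w (i + l) (v c) = w (a + 1) (v c) := walk_apply_eq hfun (by omega) him hno
      rw [hret, ← hwa, hda, hsa] at hend
      exact Bool.not_ne_self _ hend
    obtain ⟨b, ⟨hab, hbl, hvb⟩, hbmin⟩ : ∃ b, (a + 1 ≤ b ∧ b < i + l ∧ v b = v c) ∧
        ∀ k, k < b → ¬ (a + 1 ≤ k ∧ k < i + l ∧ v k = v c) :=
      ⟨Nat.find hexb, Nat.find_spec hexb, fun k hk => Nat.find_min hexb hk⟩
    have hne : ∀ k, a + 1 ≤ k → k < b → v k ≠ v c := fun k hk hkb h =>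
      hbmin k hkb ⟨hk, by omega, h⟩
    have hdb : w b (v c) = !ε b := hvb ▸ (hstep b (by omega)).1.2
    have hε : ε a = !ε b := by
      rw [← hsa, ← hdb, walk_apply_eq hfun hab (by omega) hne]
    rcases hab.eq_or_lt with rfl | hlt
    · rcases hnc a (by omega) with h | h
      · exact h (hva.trans hvb.symm)
      · exact Bool.not_ne_self _ (hε.symm.trans h)
    · refine ih (b - (a + 1)) (by omega) (by omega) (a + 1) (by omega) ?_
      rw [Nat.add_sub_cancel' hab]
      funext x
      rcases lt_or_ge x (v c) with hx | hx
      · rw [(hstep b (by omega)).1.1 x (hvb ▸ hx), hfun a (by omega), step1Fun,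
          Function.update_of_ne (by omega), (hstep a (by omega)).1.1 x (hva ▸ hx), hva, hvb]
      · refine walk_apply_eq hfun hab (by omega) fun k hk hkb => ?_
        have := hmax k ⟨by omega, by omega⟩
        have := hne k hk hkb
        omega

theorem stmt17 (α : Cantor) (m : ℕ) (hm : 1 ≤ m) (v : ℕ → ℕ) (ε : ℕ → Bool)
    (hnc : ∀ i, i + 1 < m → v i ≠ v (i + 1) ∨ ε i = ε (i + 1))
    (w : ℕ → Cantor) (hw0 : w 0 = α)
    (hstep : ∀ i, i < m →
      w i ∈ step1Dom (v i) (ε i) ∧ w (i + 1) = step1Fun (v i) (ε i) (w i)) :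
    w m ≠ α := by
  have := walk_add_ne hnc hstep m hm 0 (by omega)
  rwa [zero_add, hw0] at this
end

section
/- Let (X,(f_n)) be an acyclic situation. Then A₁ ≤ʳ_c A^f. -/
open Set Topology

theorem sSeq_length (n : ℕ) : (sSeq n).length = n := by
  have h : (psiSeq n).length ≤ n := by
    have h1 : (n + 1).size ≤ n + 1 := Nat.size_le.2 Nat.lt_two_pow_self
    simp only [psiSeq, List.length_reverse, List.length_dropLast, Nat.size_eq_bits_len]
    omega
  simp only [sSeq, List.length_append, List.length_replicate]
  omega

/-! ### The trees on finite binary sequences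

Finite sequences are stored in reverse order, as in `PiNat.res`. -/

/-- `TreeEdge k r q`: the reversals of `r` and `q` are `s_k0w` and `s_k1w` for some `w`. -/
inductive TreeEdge : ℕ → List Bool → List Bool → Prop
  | base (k : ℕ) : TreeEdge k (false :: (sSeq k).reverse) (true :: (sSeq k).reverse)
  | cons (i : Bool) {k : ℕ} {r q : List Bool} :
      TreeEdge k r q → TreeEdge k (i :: r) (i :: q)

theorem TreeEdge.length_eq {k : ℕ} {r q : List Bool} (e : TreeEdge k r q) :
    q.length = r.length := by
  induction e with
  | base k => simp
  | cons i _ ih => simp [ih]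

theorem TreeEdge.lt_length {k : ℕ} {r q : List Bool} (e : TreeEdge k r q) : k < r.length := by
  induction e with
  | base k => simp [sSeq_length]
  | cons i _ ih => simp only [List.length_cons]; omega

/-- `TreeWalk r p q`: the list `p` of labelled oriented edges leads from `r` to `q`. -/
inductive TreeWalk : List Bool → List (ℕ × Bool) → List Bool → Prop
  | nil (r : List Bool) : TreeWalk r [] r
  | forward {k : ℕ} {r r' q : List Bool} {p : List (ℕ × Bool)} :
      TreeEdge k r r' → TreeWalk r' p q → TreeWalk r ((k, true) :: p) q
  | backward {k : ℕ} {r r' q : List Bool} {p : List (ℕ × Bool)} :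
      TreeEdge k r' r → TreeWalk r' p q → TreeWalk r ((k, false) :: p) q

theorem TreeWalk.cons (i : Bool) {r q : List Bool} {p : List (ℕ × Bool)} (w : TreeWalk r p q) :
    TreeWalk (i :: r) p (i :: q) := by
  induction w with
  | nil r => exact .nil _
  | forward e _ ih => exact .forward (e.cons i) ih
  | backward e _ ih => exact .backward (e.cons i) ih

theorem TreeWalk.append {r q z : List Bool} {p p' : List (ℕ × Bool)} (w : TreeWalk r p q)
    (w' : TreeWalk q p' z) : TreeWalk r (p ++ p') z := by
  induction w with
  | nil r => exact w'
  | forward e _ ih => exact .forward e (ih w')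
  | backward e _ ih => exact .backward e (ih w')

/-- A word in the letters `n^{±1}` without a factor `n^ε n^{-ε}`. -/
def ReducedWord (p : List (ℕ × Bool)) : Prop :=
  p.IsChain fun a b => a.1 ≠ b.1 ∨ a.2 = b.2

theorem ReducedWord.append_cons {p p' : List (ℕ × Bool)} (hp : ReducedWord p)
    (hp' : ReducedWord p') {l : ℕ} (hl : ∀ a ∈ p, a.1 < l) (hl' : ∀ a ∈ p', a.1 < l) (b : Bool) :
    ReducedWord (p ++ (l, b) :: p') := by
  unfold ReducedWord at *
  rw [List.isChain_append, List.isChain_cons]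
  refine ⟨hp, ⟨fun y hy => Or.inl ?_, hp'⟩, fun x hx y hy => Or.inl ?_⟩
  · exact (hl' y (List.mem_of_mem_head? hy)).ne'
  · simp only [List.head?_cons, Option.mem_def, Option.some.injEq] at hy
    subst hy
    exact (hl x (List.mem_of_mem_getLast? hx)).ne

theorem exists_treeWalk (l : ℕ) : ∀ r q : List Bool, r.length = l → q.length = l →
    ∃ p, TreeWalk r p q ∧ ReducedWord p ∧ ∀ a ∈ p, a.1 < l := by
  induction l with
  | zero =>
    intro r q hr hq
    rw [List.length_eq_zero_iff] at hr hq
    subst hr hq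
    exact ⟨[], .nil _, List.isChain_nil, by simp⟩
  | succ l ih =>
    intro r q hr hq
    obtain ⟨i, r, rfl⟩ := List.exists_cons_of_length_eq_add_one hr
    obtain ⟨j, q, rfl⟩ := List.exists_cons_of_length_eq_add_one hq
    simp only [List.length_cons, Nat.add_right_cancel_iff] at hr hq
    have hs : (sSeq l).reverse.length = l := by simp [sSeq_length]
    by_cases hij : i = j
    · subst hij
      obtain ⟨p, w, hp, hl⟩ := ih r q hr hq
      exact ⟨p, w.cons i, hp, fun a ha => (hl a ha).trans l.lt_succ_self⟩
    · obtain ⟨p, w, hp, hl⟩ := ih r _ hr hs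
      obtain ⟨p', w', hp', hl'⟩ := ih _ q hs hq
      refine ⟨p ++ (l, j) :: p', (w.cons i).append ?_, hp.append_cons hp' hl hl' j, ?_⟩
      · cases i <;> cases j <;> try exact absurd rfl hij
        · exact .forward (.base l) (w'.cons _)
        · exact .backward (.base l) (w'.cons _)
      · intro a ha
        rw [List.mem_append, List.mem_cons] at ha
        rcases ha with ha | rfl | ha
        · exact (hl a ha).trans l.lt_succ_self
        · exact l.lt_succ_self
        · exact (hl' a ha).trans l.lt_succ_self

/-! ### Words acting on an acyclic situation -/

/-- `Follows D f g p x y`: applying successively the letters of `p` to `x` is possible and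
leads to `y`. -/
def Follows {X : Type} (D : ℕ → Set X) (f g : ℕ → X → X) : List (ℕ × Bool) → X → X → Prop
  | [], x, y => x = y
  | a :: p, x, y => x ∈ stepDom D f a.1 a.2 ∧ Follows D f g p (stepFun f g a.1 a.2 x) y

theorem Follows.exists_trajectory {X : Type} {D : ℕ → Set X} {f g : ℕ → X → X}
    {p : List (ℕ × Bool)} {x y : X} (h : Follows D f g p x y) :
    ∃ w : ℕ → X, w 0 = x ∧ w p.length = y ∧ ∀ i, i < p.length →
      w i ∈ stepDom D f (p.getD i default).1 (p.getD i default).2 ∧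
      w (i + 1) = stepFun f g (p.getD i default).1 (p.getD i default).2 (w i) := by
  induction p generalizing x with
  | nil => exact ⟨fun _ => x, rfl, h, by simp⟩
  | cons a p ih =>
    obtain ⟨hx, hp⟩ := h
    obtain ⟨w, h0, hl, hw⟩ := ih hp
    refine ⟨fun i => Nat.casesOn i x w, rfl, hl, fun i hi => ?_⟩
    cases i with
    | zero => exact ⟨hx, h0⟩
    | succ i => exact hw i (by simpa using hi)

section

variable {X : Type} [t : TopologicalSpace X] {D : ℕ → Set X} {f g : ℕ → X → X}

theorem AcyclicSit.exists_not_follows (h : AcyclicSit X t D f g) {p : List (ℕ × Bool)}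
    (hp : ReducedWord p) (hne : p ≠ []) {U : Set X} (hU : IsClopen U) (hU' : U.Nonempty) :
    ∃ V, IsClopen V ∧ V.Nonempty ∧ V ⊆ U ∧ ∀ x ∈ V, ∀ y ∈ V, ¬ Follows D f g p x y := by
  obtain ⟨V, hV, hVne, hVU, hac⟩ := h.2.2.2.2.2.2.2 p.length (List.length_pos_iff.2 hne)
    (fun i => (p.getD i default).1) (fun i => (p.getD i default).2)
    (fun i hi => by
      have := List.isChain_iff_getElem.1 hp i hi
      simpa [List.getD_eq_getElem, hi, (Nat.lt_succ_self i).trans hi] using this) U hU hU'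
  refine ⟨V, hV, hVne, hVU, fun x hx y hy hxy => ?_⟩
  obtain ⟨w, h0, hl, hw⟩ := hxy.exists_trajectory
  exact hac x hx w h0 hw (hl ▸ hy)

theorem AcyclicSit.isClopen_dom (h : AcyclicSit X t D f g) (n : ℕ) : IsClopen (D n) :=
  (h.2.2.2.2.1 n).1

theorem AcyclicSit.continuousOn (h : AcyclicSit X t D f g) (n : ℕ) : ContinuousOn (f n) (D n) :=
  (h.2.2.2.2.1 n).2.2.1

theorem AcyclicSit.left_inv (h : AcyclicSit X t D f g) {n : ℕ} {x : X} (hx : x ∈ D n) :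
    g n (f n x) = x :=
  h.2.2.2.2.2.1 n x hx

theorem AcyclicSit.apply_ne_self (h : AcyclicSit X t D f g) {n : ℕ} {x : X} (hx : x ∈ D n) :
    f n x ≠ x := fun hfx =>
  (h.2.2.2.2.2.2.1 (rfl : ((x, x) : X × X).1 = (x, x).2)).2
    (mem_iUnion.2 ⟨n, hx, hfx.symm⟩)

theorem ContinuousOn.isClopen_inter_preimage {Y Z : Type*} [TopologicalSpace Y]
    [TopologicalSpace Z] {u : Y → Z} {A : Set Y} {V : Set Z} (hu : ContinuousOn u A)
    (hA : IsClopen A) (hV : IsClopen V) : IsClopen (A ∩ u ⁻¹' V) :=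
  ⟨hu.preimage_isClosed_of_isClosed hA.1 hV.1, hu.isOpen_inter_preimage hA.2 hV.2⟩

theorem AcyclicSit.isClopen_image (h : AcyclicSit X t D f g) {n : ℕ} {V : Set X}
    (hV : IsClopen V) (hVD : V ⊆ D n) : IsClopen (f n '' V) := by
  obtain ⟨-, hR, -, g', hg', hgf⟩ := h.2.2.2.2.1 n
  convert hg'.isClopen_inter_preimage hR hV using 1
  ext y
  constructor
  · rintro ⟨x, hx, rfl⟩
    exact ⟨mem_image_of_mem _ (hVD hx), by rwa [mem_preimage, hgf x (hVD hx)]⟩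
  · rintro ⟨⟨x, hx, rfl⟩, hy⟩
    rw [mem_preimage, hgf x hx] at hy
    exact mem_image_of_mem _ hy

/-- Infinitely many of the partial maps have a graph meeting a given open square. -/
theorem AcyclicSit.exists_mem_dom (h : AcyclicSit X t D f g) {U : Set X} (hU : IsOpen U)
    (hne : U.Nonempty) (N : ℕ) : ∃ n, N ≤ n ∧ ∃ x ∈ U, x ∈ D n ∧ f n x ∈ U := by
  have := h.2.1
  obtain ⟨z, hz⟩ := hne
  have hgraph (n : ℕ) : IsClosed (graphRel (D n) (f n)) := by
    have hc : ContinuousOn (fun p : X × X => (p.2, f n p.1)) (D n ×ˢ univ) :=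
      continuousOn_snd.prodMk ((h.continuousOn n).comp continuousOn_fst fun p hp => hp.1)
    convert hc.preimage_isClosed_of_isClosed ((h.isClopen_dom n).1.prod isClosed_univ)
      isClosed_diagonal using 1
    ext p
    simp [graphRel]
  have hcl := (h.2.2.2.2.2.2.1 (rfl : ((z, z) : X × X).1 = (z, z).2)).1
  have hopen : IsOpen ((U ×ˢ U) \ ⋃ n ∈ Iio N, graphRel (D n) (f n)) :=
    (hU.prod hU).sdiff ((finite_Iio N).isClosed_biUnion fun n _ => hgraph n)
  obtain ⟨⟨x, y⟩, ⟨⟨hx, hy⟩, hN⟩, hxy⟩ := mem_closure_iff.1 hcl _ hopen ⟨⟨hz, hz⟩, by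
    simp only [mem_iUnion, not_exists]
    exact fun n _ hn => h.apply_ne_self hn.1 hn.2.symm⟩
  obtain ⟨n, hxD, hfx⟩ := mem_iUnion.1 hxy
  refine ⟨n, not_lt.1 fun hn => hN (mem_biUnion hn ⟨hxD, hfx⟩), x, hx, hxD, ?_⟩
  have hfx : y = f n x := hfx
  exact hfx ▸ hy

/-! ### Compatible families of clopen sets -/

/-- A family of nonempty clopen sets indexed by the finite sequences of length `l` such that
`f_{φ k}` carries `U r` onto `U q` for each edge `(r, q)` with label `k`. -/
structure Compatible {X : Type} [TopologicalSpace X] (D : ℕ → Set X) (f : ℕ → X → X)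
    (φ : ℕ → ℕ) (l : ℕ) (U : List Bool → Set X) : Prop where
  isClopen : ∀ r, r.length = l → IsClopen (U r)
  nonempty : ∀ r, r.length = l → (U r).Nonempty
  subset_dom : ∀ k r q, TreeEdge k r q → r.length = l → U r ⊆ D (φ k)
  image_eq : ∀ k r q, TreeEdge k r q → r.length = l → f (φ k) '' U r = U q

/-- The family of sets whose two halves are `A` and `B`. -/
def glue {X : Type} (A B : List Bool → Set X) : List Bool → Set X
  | [] => ∅
  | false :: r => A r
  | true :: r => B r

theorem Compatible.congr {φ φ' : ℕ → ℕ} {l : ℕ} {U : List Bool → Set X}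
    (hU : Compatible D f φ l U) (hφ : ∀ k < l, φ' k = φ k) : Compatible D f φ' l U where
  isClopen := hU.isClopen
  nonempty := hU.nonempty
  subset_dom k r q e hr := by
    rw [hφ k (hr ▸ e.lt_length)]
    exact hU.subset_dom k r q e hr
  image_eq k r q e hr := by
    rw [hφ k (hr ▸ e.lt_length)]
    exact hU.image_eq k r q e hr

theorem Compatible.half {φ : ℕ → ℕ} {l : ℕ} {U : List Bool → Set X}
    (hU : Compatible D f φ (l + 1) U) (i : Bool) : Compatible D f φ l fun r => U (i :: r) where
  isClopen r hr := hU.isClopen (i :: r) (by simp [hr])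
  nonempty r hr := hU.nonempty (i :: r) (by simp [hr])
  subset_dom k r q e hr := hU.subset_dom k _ _ (e.cons i) (by simp [hr])
  image_eq k r q e hr := hU.image_eq k _ _ (e.cons i) (by simp [hr])

theorem Compatible.glue {φ : ℕ → ℕ} {l : ℕ} {A B : List Bool → Set X}
    (hA : Compatible D f φ l A) (hB : Compatible D f φ l B)
    (hD : A (sSeq l).reverse ⊆ D (φ l))
    (hf : f (φ l) '' A (sSeq l).reverse = B (sSeq l).reverse) :
    Compatible D f φ (l + 1) (glue A B) where
  isClopen r hr := by
    obtain ⟨i, r, rfl⟩ := List.exists_cons_of_length_eq_add_one hr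
    cases i
    · exact hA.isClopen r (by simpa using hr)
    · exact hB.isClopen r (by simpa using hr)
  nonempty r hr := by
    obtain ⟨i, r, rfl⟩ := List.exists_cons_of_length_eq_add_one hr
    cases i
    · exact hA.nonempty r (by simpa using hr)
    · exact hB.nonempty r (by simpa using hr)
  subset_dom k r q e hr := by
    cases e with
    | base k =>
      obtain rfl : k = l := by simpa [sSeq_length] using hr
      exact hD
    | cons i e =>
      cases i
      · exact hA.subset_dom k _ _ e (by simpa using hr)
      · exact hB.subset_dom k _ _ e (by simpa using hr)
  image_eq k r q e hr := by
    cases e with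
    | base k =>
      obtain rfl : k = l := by simpa [sSeq_length] using hr
      exact hf
    | cons i e =>
      cases i
      · exact hA.image_eq k _ _ e (by simpa using hr)
      · exact hB.image_eq k _ _ e (by simpa using hr)

theorem Compatible.exists_follows (h : AcyclicSit X t D f g) {φ : ℕ → ℕ} {l : ℕ}
    {U : List Bool → Set X} (hU : Compatible D f φ l U) {r q : List Bool}
    {p : List (ℕ × Bool)} (w : TreeWalk r p q) (hr : r.length = l) {x : X} (hx : x ∈ U r) :
    ∃ y ∈ U q, Follows D f g (p.map (Prod.map φ id)) x y := by
  induction w generalizing x with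
  | nil r => exact ⟨x, hx, rfl⟩
  | forward e _ ih =>
    obtain ⟨y, hy, hxy⟩ := ih (e.length_eq.trans hr)
      (hU.image_eq _ _ _ e hr ▸ mem_image_of_mem _ hx)
    exact ⟨y, hy, hU.subset_dom _ _ _ e hr hx, hxy⟩
  | backward e _ ih =>
    have hr' := e.length_eq.symm.trans hr
    rw [← hU.image_eq _ _ _ e hr'] at hx
    obtain ⟨z, hz, rfl⟩ := hx
    have hzD := hU.subset_dom _ _ _ e hr' hz
    obtain ⟨y, hy, hzy⟩ := ih hr' hz
    refine ⟨y, hy, mem_image_of_mem _ hzD, ?_⟩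
    simpa [stepFun, h.left_inv hzD] using hzy

/-- A compatible family can be shrunk so as to take a prescribed smaller value at one node. -/
theorem Compatible.exists_shrink (h : AcyclicSit X t D f g) {φ : ℕ → ℕ} {l : ℕ} :
    ∀ {U : List Bool → Set X}, Compatible D f φ l U → ∀ {r : List Bool}, r.length = l →
    ∀ {V : Set X}, IsClopen V → V.Nonempty → V ⊆ U r →
    ∃ U', Compatible D f φ l U' ∧ (∀ s, s.length = l → U' s ⊆ U s) ∧ U' r = V := by
  induction l with
  | zero =>
    intro U hU r hr V hV hne hVU
    rw [List.length_eq_zero_iff] at hr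
    subst hr
    refine ⟨fun _ => V, ⟨fun _ _ => hV, fun _ _ => hne, ?_, ?_⟩, ?_, rfl⟩
    · intro k r q e hr
      exact absurd e.lt_length (by omega)
    · intro k r q e hr
      exact absurd e.lt_length (by omega)
    · intro s hs
      rw [List.length_eq_zero_iff] at hs
      exact hs ▸ hVU
  | succ l ih =>
    intro U hU r hr V hV hne hVU
    obtain ⟨i, r, rfl⟩ := List.exists_cons_of_length_eq_add_one hr
    replace hr : r.length = l := by simpa using hr
    have hs : (sSeq l).reverse.length = l := by simp [sSeq_length]
    have hs' : (false :: (sSeq l).reverse).length = l + 1 := by simp [sSeq_length]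
    have hsD := hU.subset_dom _ _ _ (.base l) hs'
    have hsf := hU.image_eq _ _ _ (.base l) hs'
    obtain ⟨A, hA, hAU, hAr⟩ := ih (hU.half i) hr hV hne hVU
    have hAs := hAU _ hs
    cases i with
    | false =>
      obtain ⟨B, hB, hBU, hBs⟩ := ih (hU.half true) hs
        (h.isClopen_image (hA.isClopen _ hs) (hAs.trans hsD)) ((hA.nonempty _ hs).image _)
        (hsf ▸ image_mono hAs)
      refine ⟨_, hA.glue hB (hAs.trans hsD) hBs.symm, ?_, hAr⟩
      intro s hs
      obtain ⟨i, s, rfl⟩ := List.exists_cons_of_length_eq_add_one hs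
      cases i
      · exact hAU s (by simpa using hs)
      · exact hBU s (by simpa using hs)
    | true =>
      have hV' : f (φ l) '' (U (false :: (sSeq l).reverse) ∩ f (φ l) ⁻¹' A (sSeq l).reverse) =
          A (sSeq l).reverse := by
        rw [image_inter_preimage, hsf, inter_eq_right]
        exact hAs
      obtain ⟨B, hB, hBU, hBs⟩ := ih (hU.half false) hs
        (((h.continuousOn (φ l)).mono hsD).isClopen_inter_preimage (hU.isClopen _ hs')
          (hA.isClopen _ hs))
        (image_nonempty.1 (hV' ▸ hA.nonempty _ hs)) inter_subset_left
      refine ⟨_, hB.glue hA (hBs ▸ inter_subset_left.trans hsD) (hBs ▸ hV'), ?_, hAr⟩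
      intro s hs
      obtain ⟨i, s, rfl⟩ := List.exists_cons_of_length_eq_add_one hs
      cases i
      · exact hBU s (by simpa using hs)
      · exact hAU s (by simpa using hs)

theorem Compatible.exists_extend (h : AcyclicSit X t D f g) {φ : ℕ → ℕ} (hφ : StrictMono φ)
    {l : ℕ} {U : List Bool → Set X} (hU : Compatible D f φ l U) :
    ∃ φ' U', StrictMono φ' ∧ (∀ k < l, φ' k = φ k) ∧ Compatible D f φ' (l + 1) U' ∧
      ∀ s, s.length = l → ∀ i, U' (i :: s) ⊆ U s := by
  have hs : (sSeq l).reverse.length = l := by simp [sSeq_length]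
  have hUs := hU.isClopen _ hs
  obtain ⟨n, hn, x, hx, hxD, hfx⟩ := h.exists_mem_dom hUs.2 (hU.nonempty _ hs) (φ l)
  set φ' : ℕ → ℕ := fun k => if k < l then φ k else n + (k - l) with hφ'
  have hφl : φ' l = n := by simp [hφ']
  have hφk : ∀ k < l, φ' k = φ k := fun k hk => by simp [hφ', hk]
  have hV : IsClopen (U (sSeq l).reverse ∩ (D n ∩ f n ⁻¹' U (sSeq l).reverse)) :=
    hUs.inter ((h.continuousOn n).isClopen_inter_preimage (h.isClopen_dom n) hUs)
  have hVD : U (sSeq l).reverse ∩ (D n ∩ f n ⁻¹' U (sSeq l).reverse) ⊆ D n := fun y hy => hy.2.1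
  have hVne : (U (sSeq l).reverse ∩ (D n ∩ f n ⁻¹' U (sSeq l).reverse)).Nonempty :=
    ⟨x, hx, hxD, hfx⟩
  obtain ⟨A, hA, hAU, hAs⟩ := (hU.congr hφk).exists_shrink h hs hV hVne inter_subset_left
  obtain ⟨B, hB, hBU, hBs⟩ := (hU.congr hφk).exists_shrink h hs (h.isClopen_image hV hVD)
    (hVne.image _) (image_subset_iff.2 fun y hy => hy.2.2)
  refine ⟨φ', _, strictMono_nat_of_lt_succ fun k => ?_, hφk,
    hA.glue hB (by rwa [hφl, hAs]) (by rw [hφl, hAs, hBs]), fun s hs i => ?_⟩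
  · rcases lt_trichotomy (k + 1) l with hk | hk | hk
    · rw [hφk k (by omega), hφk _ hk]
      exact hφ k.lt_succ_self
    · rw [hφk k (by omega), hk, hφl]
      exact (hφ (by omega)).trans_le hn
    · simp only [hφ', if_neg (show ¬ k < l by omega), if_neg (show ¬ k + 1 < l by omega)]
      omega
  · cases i
    · exact hAU s hs
    · exact hBU s hs

/-- Finitely many requirements that are preserved by shrinking can be met simultaneously. -/
theorem Compatible.exists_forall_mem {φ : ℕ → ℕ} {l : ℕ} {U : List Bool → Set X}
    (hU : Compatible D f φ l U) {ι : Type*} {S : Set ι} (hS : S.Finite)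
    (Q : ι → (List Bool → Set X) → Prop)
    (hanti : ∀ i A B, (∀ s, s.length = l → A s ⊆ B s) → Q i B → Q i A)
    (hQ : ∀ i ∈ S, ∀ A, Compatible D f φ l A → (∀ s, s.length = l → A s ⊆ U s) →
      ∃ B, Compatible D f φ l B ∧ (∀ s, s.length = l → B s ⊆ A s) ∧ Q i B) :
    ∃ A, Compatible D f φ l A ∧ (∀ s, s.length = l → A s ⊆ U s) ∧ ∀ i ∈ S, Q i A := by
  induction S, hS using Set.Finite.induction_on with
  | empty => exact ⟨U, hU, fun _ _ => Subset.rfl, by simp⟩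
  | @insert a S _ _ ih =>
    obtain ⟨A, hA, hAU, hAQ⟩ := ih fun i hi => hQ i (mem_insert_of_mem _ hi)
    obtain ⟨B, hB, hBA, hBQ⟩ := hQ a (mem_insert _ _) A hA hAU
    refine ⟨B, hB, fun s hs => (hBA s hs).trans (hAU s hs), fun i hi => ?_⟩
    rcases hi with rfl | hi
    · exact hBQ
    · exact hanti i B A hBA (hAQ i hi)

/-- A nonempty reduced word can be prevented from leading from `U r` back to `U r`. -/
theorem Compatible.exists_not_follows (h : AcyclicSit X t D f g) {φ : ℕ → ℕ} {l : ℕ}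
    {U : List Bool → Set X} (hU : Compatible D f φ l U) {p : List (ℕ × Bool)}
    (hp : ReducedWord p) (hne : p ≠ []) {r : List Bool} (hr : r.length = l) :
    ∃ U', Compatible D f φ l U' ∧ (∀ s, s.length = l → U' s ⊆ U s) ∧
      ∀ x ∈ U' r, ∀ y ∈ U' r, ¬ Follows D f g p x y := by
  obtain ⟨V, hV, hVne, hVU, hVp⟩ :=
    h.exists_not_follows hp hne (hU.isClopen r hr) (hU.nonempty r hr)
  obtain ⟨U', hU', hle, hr'⟩ := hU.exists_shrink h hr hV hVne hVU
  exact ⟨U', hU', hle, by rwa [hr']⟩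

theorem ReducedWord.map {φ : ℕ → ℕ} (hφ : Function.Injective φ) {p : List (ℕ × Bool)}
    (hp : ReducedWord p) : ReducedWord (p.map (Prod.map φ id)) := by
  unfold ReducedWord at *
  rw [List.isChain_map]
  exact hp.imp fun a b hab => hab.imp hφ.ne id

theorem Compatible.exists_disjoint (h : AcyclicSit X t D f g) {φ : ℕ → ℕ}
    (hφ : Function.Injective φ) {l : ℕ} {U : List Bool → Set X} (hU : Compatible D f φ l U) :
    ∃ U', Compatible D f φ l U' ∧ (∀ s, s.length = l → U' s ⊆ U s) ∧
      ∀ r q, r.length = l → q.length = l → r ≠ q → Disjoint (U' r) (U' q) := by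
  have hfin := List.finite_length_eq Bool l
  obtain ⟨U', hU', hle, hQ⟩ := hU.exists_forall_mem (hfin.prod hfin)
    (fun a A => a.1.length = l → a.2.length = l → a.1 ≠ a.2 → Disjoint (A a.1) (A a.2))
    (fun a A B hAB hB h1 h2 hne => (hB h1 h2 hne).mono (hAB _ h1) (hAB _ h2)) (by
      rintro ⟨r, q⟩ ⟨hr, hq⟩ A hA -
      by_cases hne : r = q
      · exact ⟨A, hA, fun _ _ => Subset.rfl, fun _ _ hne' => absurd hne hne'⟩
      obtain ⟨p, w, hp, -⟩ := exists_treeWalk l r q hr hq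
      have hpne : p ≠ [] := by
        rintro rfl
        cases w
        exact hne rfl
      obtain ⟨B, hB, hBA, hBp⟩ := hA.exists_not_follows h (hp.map hφ) (by simpa using hpne) hq
      refine ⟨B, hB, hBA, fun _ _ _ => disjoint_left.2 fun x hxr hxq => ?_⟩
      obtain ⟨y, hy, hxy⟩ := hB.exists_follows h w hr hxr
      exact hBp x hxq y hy hxy)
  exact ⟨U', hU', hle, fun r q hr hq => hQ (r, q) ⟨hr, hq⟩ hr hq⟩

theorem Compatible.exists_avoid (h : AcyclicSit X t D f g) {φ : ℕ → ℕ}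
    (hφ : Function.Injective φ) {l : ℕ} {U : List Bool → Set X} (hU : Compatible D f φ l U) :
    ∃ U', Compatible D f φ l U' ∧ (∀ s, s.length = l → U' s ⊆ U s) ∧
      ∀ m < l, ∀ r q, r.length = l → q.length = l → r ≠ q →
        (∀ k, TreeEdge k r q → φ k ≠ m) → ∀ x ∈ U' r, x ∈ D m → f m x ∉ U' q := by
  obtain ⟨U₀, hU₀, hle₀, hdisj⟩ := hU.exists_disjoint h hφ
  have hfin := List.finite_length_eq Bool l
  obtain ⟨U', hU', hle, hQ⟩ := hU₀.exists_forall_mem ((finite_Iio l).prod (hfin.prod hfin))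
    (fun a A => a.2.1.length = l → a.2.2.length = l → a.2.1 ≠ a.2.2 →
      (∀ k, TreeEdge k a.2.1 a.2.2 → φ k ≠ a.1) →
      ∀ x ∈ A a.2.1, x ∈ D a.1 → f a.1 x ∉ A a.2.2)
    (fun a A B hAB hB h1 h2 hne he x hx hxD hfx =>
      hB h1 h2 hne he x (hAB _ h1 hx) hxD (hAB _ h2 hfx)) (by
      rintro ⟨m, r, q⟩ ⟨-, hr, hq⟩ A hA hAU
      by_cases hne : r = q
      · exact ⟨A, hA, fun _ _ => Subset.rfl, fun _ _ hne' => absurd hne hne'⟩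
      obtain ⟨p, w, hp, -⟩ := exists_treeWalk l q r hq hr
      by_cases hred : ReducedWord ((m, true) :: p.map (Prod.map φ id))
      · obtain ⟨B, hB, hBA, hBp⟩ := hA.exists_not_follows h hred (by simp) hr
        refine ⟨B, hB, hBA, fun _ _ _ _ x hx hxD hfx => ?_⟩
        obtain ⟨y, hy, hxy⟩ := hB.exists_follows h w hq hfx
        exact hBp x hx y hy ⟨hxD, hxy⟩
      · refine ⟨A, hA, fun _ _ => Subset.rfl, fun _ _ _ he x hx hxD hfx => ?_⟩
        cases w with
        | nil => exact hne rfl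
        | forward e w => exact hred (List.isChain_cons.2 ⟨by simp, hp.map hφ⟩)
        | @backward k _ q' _ p e w =>
          by_cases hkm : φ k = m
          · subst hkm
            have hq' := e.length_eq.symm.trans hq
            have hne' : r ≠ q' := by
              rintro rfl
              exact he k e rfl
            replace hfx : f (φ k) x ∈ A q := hfx
            rw [← hA.image_eq _ _ _ e hq'] at hfx
            obtain ⟨z, hz, hzx⟩ := hfx
            have hzx' := congrArg (g (φ k)) hzx
            rw [h.left_inv (hA.subset_dom _ _ _ e hq' hz), h.left_inv hxD] at hzx'
            subst hzx'
            exact disjoint_left.1 (hdisj r q' hr hq' hne') (hAU _ hr hx) (hAU _ hq' hz)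
          · refine hred (List.isChain_cons.2 ⟨?_, hp.map hφ⟩)
            simpa using fun h => hkm h.symm)
  exact ⟨U', hU', fun s hs => (hle s hs).trans (hle₀ s hs),
    fun m hm r q hr hq => hQ (m, r, q) ⟨hm, hr, hq⟩ hr hq⟩

end

/-! ### The limit of the construction -/

theorem res_eq_reverse {n : ℕ} (s : List Bool) (x : Cantor) (hs : s.length = n)
    (hx : ∀ i (hi : i < s.length), x i = s[i]) : PiNat.res x n = s.reverse := by
  induction s using List.reverseRecOn generalizing n with
  | nil => subst hs; rfl
  | append_singleton s a ih =>
    obtain rfl : s.length + 1 = n := by simpa using hs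
    rw [PiNat.res_succ, List.reverse_concat, ih rfl fun i hi => ?_, hx s.length (by simp)]
    · simp
    · rw [hx i (by simp; omega), List.getElem_append_left hi]

theorem res_catSeq (n : ℕ) (b : Bool) (γ : Cantor) :
    PiNat.res (catSeq (sSeq n ++ [b]) γ) (n + 1) = b :: (sSeq n).reverse := by
  rw [res_eq_reverse (sSeq n ++ [b]) _ (by simp [sSeq_length]), List.reverse_concat]
  intro i hi
  simp only [catSeq, dif_pos hi, List.get_eq_getElem]

theorem catSeq_apply_of_lt (n : ℕ) (b : Bool) (γ : Cantor) {i : ℕ} (hi : n < i) :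
    catSeq (sSeq n ++ [b]) γ i = γ (i - (n + 1)) := by
  have : (sSeq n ++ [b]).length = n + 1 := by simp [sSeq_length]
  simp [catSeq, sSeq_length, show ¬ i < n + 1 by omega]

theorem eq_catSeq_iff {n : ℕ} {b : Bool} {γ x : Cantor} :
    x = catSeq (sSeq n ++ [b]) γ ↔
      PiNat.res x (n + 1) = b :: (sSeq n).reverse ∧ ∀ i, n < i → x i = γ (i - (n + 1)) := by
  constructor
  · rintro rfl
    exact ⟨res_catSeq n b γ, fun i hi => catSeq_apply_of_lt n b γ hi⟩
  · rintro ⟨hres, hx⟩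
    rw [← res_catSeq n b γ, PiNat.res_eq_res] at hres
    funext i
    rcases Nat.lt_or_ge n i with hi | hi
    · rw [hx i hi, catSeq_apply_of_lt n b γ hi]
    · exact hres (Nat.lt_succ_of_le hi)

theorem treeEdge_res_iff {k l : ℕ} {x y : Cantor} :
    TreeEdge k (PiNat.res x l) (PiNat.res y l) ↔ k < l ∧
      PiNat.res x (k + 1) = false :: (sSeq k).reverse ∧
      PiNat.res y (k + 1) = true :: (sSeq k).reverse ∧ ∀ i, k < i → i < l → x i = y i := by
  induction l with
  | zero =>
    refine ⟨fun e => absurd e.lt_length (by simp), fun h => absurd h.1 (by omega)⟩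
  | succ l ih =>
    constructor
    · intro e
      rw [PiNat.res_succ x l, PiNat.res_succ y l] at e
      generalize hr : x l :: PiNat.res x l = r at e
      generalize hq : y l :: PiNat.res y l = q at e
      cases e with
      | base k =>
        have hk : k = l := by
          have := congrArg List.length hr
          simpa [sSeq_length] using this.symm
        subst hk
        exact ⟨k.lt_succ_self, hr, hq, fun i h1 h2 => by omega⟩
      | cons i e =>
        rw [List.cons.injEq] at hr hq
        obtain ⟨hxi, rfl⟩ := hr
        obtain ⟨hyi, rfl⟩ := hq
        obtain ⟨hk, hx, hy, hxy⟩ := ih.1 e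
        refine ⟨hk.trans l.lt_succ_self, hx, hy, fun j hj hjl => ?_⟩
        rcases Nat.lt_succ_iff_lt_or_eq.1 hjl with hjl | rfl
        · exact hxy j hj hjl
        · rw [hxi, hyi]
    · rintro ⟨hk, hx, hy, hxy⟩
      rcases Nat.lt_succ_iff_lt_or_eq.1 hk with hk | rfl
      · rw [PiNat.res_succ x l, PiNat.res_succ y l, hxy l hk l.lt_succ_self]
        exact .cons _ (ih.2 ⟨hk, hx, hy, fun j hj hjl => hxy j hj (hjl.trans l.lt_succ_self)⟩)
      · rw [hx, hy]
        exact .base _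

theorem mem_A1_iff {x y : Cantor} :
    (x, y) ∈ A1 ↔ ∃ k, ∀ l, k < l → TreeEdge k (PiNat.res x l) (PiNat.res y l) := by
  constructor
  · rintro ⟨k, γ, hx, hy⟩
    obtain ⟨hx, hx'⟩ := eq_catSeq_iff.1 hx
    obtain ⟨hy, hy'⟩ := eq_catSeq_iff.1 hy
    exact ⟨k, fun l hl => treeEdge_res_iff.2
      ⟨hl, hx, hy, fun i hi _ => (hx' i hi).trans (hy' i hi).symm⟩⟩
  · rintro ⟨k, hk⟩
    obtain ⟨-, hx, hy, -⟩ := treeEdge_res_iff.1 (hk (k + 1) k.lt_succ_self)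
    refine ⟨k, fun i => x (i + (k + 1)), eq_catSeq_iff.2 ⟨hx, fun i hi => ?_⟩,
      eq_catSeq_iff.2 ⟨hy, fun i hi => ?_⟩⟩
    · simp only [Nat.sub_add_cancel (Nat.succ_le_of_lt hi)]
    · simp only [Nat.sub_add_cancel (Nat.succ_le_of_lt hi)]
      exact ((treeEdge_res_iff.1 (hk (i + 1) (by omega))).2.2.2 i hi i.lt_succ_self).symm

/-- The label of the edge between the restrictions of `x` and `y` does not depend on the length of
the restrictions. -/
theorem TreeEdge.label_unique {k k' l l' : ℕ} {x y : Cantor}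
    (e : TreeEdge k (PiNat.res x l) (PiNat.res y l))
    (e' : TreeEdge k' (PiNat.res x l') (PiNat.res y l')) : k = k' := by
  have key : ∀ {k k' : ℕ}, PiNat.res x (k + 1) = false :: (sSeq k).reverse →
      PiNat.res y (k + 1) = true :: (sSeq k).reverse →
      PiNat.res x (k' + 1) = false :: (sSeq k').reverse →
      PiNat.res y (k' + 1) = true :: (sSeq k').reverse → ¬ k < k' := by
    intro k k' hx hy hx' hy' hlt
    rw [PiNat.res_succ, List.cons.injEq] at hx hy hx' hy'
    have := PiNat.res_eq_res.1 (hx'.2.trans hy'.2.symm) hlt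
    rw [hx.1, hy.1] at this
    exact Bool.false_ne_true this
  obtain ⟨-, hx, hy, -⟩ := treeEdge_res_iff.1 e
  obtain ⟨-, hx', hy', -⟩ := treeEdge_res_iff.1 e'
  exact le_antisymm (not_lt.1 (key hx' hy' hx hy)) (not_lt.1 (key hx hy hx' hy'))

section

variable {X : Type} [MetricSpace X] {D : ℕ → Set X} {f g : ℕ → X → X}

/-- The properties of the family of sets chosen at level `l` of the construction. -/
structure IsStage (D : ℕ → Set X) (f : ℕ → X → X) (l : ℕ)
    (σ : (ℕ → ℕ) × (List Bool → Set X)) : Prop where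
  strictMono : StrictMono σ.1
  compatible : Compatible D f σ.1 l σ.2
  avoid : ∀ m < l, ∀ r q, r.length = l → q.length = l → r ≠ q →
    (∀ k, TreeEdge k r q → σ.1 k ≠ m) → ∀ x ∈ σ.2 r, x ∈ D m → f m x ∉ σ.2 q
  ediam_le : ∀ r, r.length = l → Metric.ediam (σ.2 r) ≤ 2 * (l : ENNReal)⁻¹

theorem Compatible.exists_ediam_le (h : AcyclicSit X inferInstance D f g) {φ : ℕ → ℕ} {l : ℕ}
    {U : List Bool → Set X} (hU : Compatible D f φ l U) {ε : ENNReal} (hε : ε ≠ 0) :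
    ∃ U', Compatible D f φ l U' ∧ (∀ s, s.length = l → U' s ⊆ U s) ∧
      ∀ r, r.length = l → Metric.ediam (U' r) ≤ 2 * ε := by
  obtain ⟨U', hU', hle, hQ⟩ := hU.exists_forall_mem (List.finite_length_eq Bool l)
    (fun r A => r.length = l → Metric.ediam (A r) ≤ 2 * ε)
    (fun r A B hAB hB hr => (Metric.ediam_mono (hAB r hr)).trans (hB hr)) (by
      rintro r hr A hA -
      obtain ⟨x, hx⟩ := hA.nonempty r hr
      obtain ⟨V, hV, hxV, hVε⟩ := h.2.2.1.exists_subset_of_mem_open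
        (Metric.mem_eball_self (pos_iff_ne_zero.2 hε)) (Metric.isOpen_eball (x := x))
      obtain ⟨B, hB, hBA, hBr⟩ := hA.exists_shrink h hr ((hA.isClopen r hr).inter hV) ⟨x, hx, hxV⟩
        inter_subset_left
      refine ⟨B, hB, hBA, fun _ => ?_⟩
      rw [hBr]
      exact (Metric.ediam_mono (inter_subset_right.trans hVε)).trans Metric.ediam_eball_le)
  exact ⟨U', hU', hle, fun r hr => hQ r hr hr⟩

theorem Compatible.exists_isStage (h : AcyclicSit X inferInstance D f g) {φ : ℕ → ℕ}
    (hφ : StrictMono φ) {l : ℕ} {U : List Bool → Set X} (hU : Compatible D f φ l U) :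
    ∃ U', IsStage D f l (φ, U') ∧ ∀ s, s.length = l → U' s ⊆ U s := by
  obtain ⟨A, hA, hAU, hAa⟩ := hU.exists_avoid h hφ.injective
  obtain ⟨B, hB, hBA, hBd⟩ := hA.exists_ediam_le h
    (ENNReal.inv_ne_zero.2 (ENNReal.natCast_ne_top l))
  exact ⟨B, ⟨hφ, hB, fun m hm r q hr hq hne he x hx hxD hfx =>
    hAa m hm r q hr hq hne he x (hBA r hr hx) hxD (hBA q hq hfx), hBd⟩,
    fun s hs => (hBA s hs).trans (hAU s hs)⟩

theorem AcyclicSit.exists_stages (h : AcyclicSit X inferInstance D f g) :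
    ∃ (Φ : ℕ → ℕ) (A : List Bool → Set X), (∀ l, IsStage D f l (Φ, A)) ∧
      ∀ r i, A (i :: r) ⊆ A r := by
  have := h.1
  obtain ⟨U₀, hU₀, -⟩ := Compatible.exists_isStage (φ := id) (l := 0) (U := fun _ => univ) h
    strictMono_id ⟨fun _ _ => isClopen_univ, fun _ _ => univ_nonempty,
      fun k r q e hr => absurd e.lt_length (by omega),
      fun k r q e hr => absurd e.lt_length (by omega)⟩
  have hstep (l : ℕ) (σ : {σ // IsStage D f l σ}) : ∃ τ : {τ // IsStage D f (l + 1) τ},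
      (∀ k < l, τ.1.1 k = σ.1.1 k) ∧ ∀ r, r.length = l → ∀ i, τ.1.2 (i :: r) ⊆ σ.1.2 r := by
    obtain ⟨φ', U', hφ', hφ, hU', hsub⟩ := σ.2.compatible.exists_extend h σ.2.strictMono
    obtain ⟨A, hA, hAU⟩ := hU'.exists_isStage h hφ'
    exact ⟨⟨_, hA⟩, hφ, fun r hr i => (hAU (i :: r) (by simp [hr])).trans (hsub r hr i)⟩
  choose next hnext₁ hnext₂ using hstep
  let σ : ∀ l, {σ // IsStage D f l σ} := fun l => Nat.rec ⟨_, hU₀⟩ next l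
  have hσ₁ (k l : ℕ) (hkl : k < l) : (σ l).1.1 k = (σ (k + 1)).1.1 k := by
    induction l, hkl using Nat.le_induction with
    | base => rfl
    | succ l hkl ih => exact (hnext₁ l (σ l) k hkl).trans ih
  have hσ₂ (r : List Bool) (l : ℕ) (hr : r.length = l) :
      (σ r.length).1.2 r = (σ l).1.2 r := by
    rw [hr]
  refine ⟨fun k => (σ (k + 1)).1.1 k, fun r => (σ r.length).1.2 r, fun l => ?_,
    fun r i => hnext₂ r.length (σ r.length) r rfl i⟩
  have hs := (σ l).2
  refine ⟨strictMono_nat_of_lt_succ fun k => ?_, ⟨?_, ?_, ?_, ?_⟩, ?_, ?_⟩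
  · rw [← hσ₁ k (k + 1 + 1) (by omega)]
    exact (σ (k + 1 + 1)).2.strictMono k.lt_succ_self
  · rintro r rfl
    exact hs.compatible.isClopen r rfl
  · rintro r rfl
    exact hs.compatible.nonempty r rfl
  · rintro k r q e rfl
    simp only [← hσ₁ k _ e.lt_length]
    exact hs.compatible.subset_dom k r q e rfl
  · rintro k r q e rfl
    simp only [← hσ₁ k _ e.lt_length]
    exact (hs.compatible.image_eq k r q e rfl).trans (hσ₂ q _ e.length_eq).symm
  · rintro m hm r q rfl hq hne he
    dsimp only
    rw [hσ₂ q _ hq]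
    refine hs.avoid m hm r q rfl hq hne fun k e => ?_
    rw [hσ₁ k _ e.lt_length]
    exact he k e
  · rintro r rfl
    exact hs.ediam_le r rfl

theorem AcyclicSit.redRC [CompleteSpace X] (h : AcyclicSit X inferInstance D f g) :
    RedRC inferInstance inferInstance inferInstance inferInstance A1 (unionGraphs D f) := by
  obtain ⟨Φ, A, hA, hanti⟩ := h.exists_stages
  have hdiam : CantorScheme.VanishingDiam A := by
    intro x
    refine tendsto_of_tendsto_of_tendsto_of_le_of_le tendsto_const_nhds ?_
      (fun n => zero_le) fun n => (hA n).ediam_le _ (PiNat.res_length x n)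
    simpa using ENNReal.Tendsto.const_mul ENNReal.tendsto_inv_nat_nhds_zero
      (Or.inr (ENNReal.ofNat_ne_top (n := 2)))
  have hclosed (r : List Bool) : IsClosed (A r) :=
    ((hA r.length).compatible.isClopen r rfl).1
  have huniv := CantorScheme.ClosureAntitone.map_of_vanishingDiam hdiam
    (CantorScheme.Antitone.closureAntitone hanti hclosed)
    fun r => (hA r.length).compatible.nonempty r rfl
  obtain ⟨u, hu, hmem⟩ : ∃ u : Cantor → X, Continuous u ∧ ∀ x n, u x ∈ A (PiNat.res x n) :=
    ⟨fun x => (CantorScheme.inducedMap A).2 ⟨x, huniv ▸ mem_univ x⟩,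
      hdiam.map_continuous.comp (by fun_prop), fun x n => CantorScheme.map_mem _ n⟩
  refine ⟨u, u, hu, hu, ?_⟩
  ext ⟨x, y⟩
  constructor
  · intro hxy
    obtain ⟨k, hk⟩ := mem_A1_iff.1 hxy
    have hD := (hA (k + 1)).compatible.subset_dom _ _ _ (hk _ k.lt_succ_self)
      (PiNat.res_length _ _) (hmem x _)
    refine mem_iUnion.2 ⟨Φ k, hD, ?_⟩
    have hf (l : ℕ) : f (Φ k) (u x) ∈ A (PiNat.res y l) := by
      have hlt (l : ℕ) (hl : k < l) : f (Φ k) (u x) ∈ A (PiNat.res y l) := by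
        have himage : f (Φ k) '' A (PiNat.res x l) = A (PiNat.res y l) :=
          (hA l).compatible.image_eq _ _ _ (hk l hl) (PiNat.res_length _ _)
        exact himage ▸ mem_image_of_mem _ (hmem x l)
      have hle : Antitone fun n => A (PiNat.res y n) :=
        antitone_nat_of_succ_le fun n => hanti _ _
      exact hle (le_max_left l (k + 1)) (hlt _ (le_max_right l (k + 1)))
    refine eq_of_forall_dist_le fun ε hε => ?_
    obtain ⟨n, hn⟩ := hdiam.dist_lt ε hε y
    exact (hn _ (hmem y n) _ (hf n)).le
  · intro hxy
    obtain ⟨m, hxD, hfx⟩ := mem_iUnion.1 hxy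
    replace hfx : u y = f m (u x) := hfx
    have hne : x ≠ y := by
      rintro rfl
      exact h.apply_ne_self hxD hfx.symm
    obtain ⟨i, hi⟩ := Function.ne_iff.1 hne
    have hedge (l : ℕ) (hl : max m i < l) :
        ∃ k, TreeEdge k (PiNat.res x l) (PiNat.res y l) := by
      by_contra hk
      simp only [not_exists] at hk
      refine (hA l).avoid m (by omega) _ _ (PiNat.res_length _ _) (PiNat.res_length _ _)
        (fun hres => hi (PiNat.res_eq_res.1 hres (by omega))) (fun k e => absurd e (hk k))
        _ (hmem x l) hxD ?_
      rw [← hfx]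
      exact hmem y l
    obtain ⟨k, e⟩ := hedge _ (Nat.lt_succ_self _)
    refine mem_A1_iff.2 ⟨k, fun l hl => ?_⟩
    obtain ⟨k', e'⟩ := hedge (max (max m i) l + 1) (by omega)
    obtain rfl := e.label_unique e'
    obtain ⟨-, hx, hy, hxy⟩ := treeEdge_res_iff.1 e'
    exact treeEdge_res_iff.2 ⟨hl, hx, hy, fun j hj hjl => hxy j hj (by omega)⟩

end

theorem stmt18 {X : Type} (t : TopologicalSpace X) (D : ℕ → Set X) (f g : ℕ → X → X)
    (h : AcyclicSit X t D f g) :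
    RedRC inferInstance inferInstance t t A1 (unionGraphs D f) := by
  have := h.2.1
  let := TopologicalSpace.upgradeIsCompletelyMetrizable X
  exact AcyclicSit.redRC h
end
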